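/- arXiv:2007.02098 — 4 statements merged into one kernel-verified Lean document; each statement's English description precedes it below -/
import Mathlib

section
/- Let 0 < ν < 1, μ ≥ 0, x > 0 and s > 0. Then ∫_0^∞ e^{-s t} · t^{μ-1} · W_{-ν,μ}(-x·t^{-ν}) dt = s^{-μ} · e^{-x·s^ν} (Stanković's Laplace transform formula). -/
/-- The Wright function `W_{λ,μ}(x) = ∑ xⁿ/(n!·Γ(λn+μ))` for real parameters and
real argument, with the convention `1/Γ(w) = 0` at poles of `Γ`.
For first parameter in `(-1,0)` this is a Wright function of the second kind. -/
noncomputable def wright (l μ x : ℝ) : ℝ :=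
  ∑' n : ℕ, x ^ n / ((n.factorial : ℝ) * Real.Gamma (l * n + μ))

open MeasureTheory Filter Topology Set

theorem integrable_of_exp_bounds {E : Type*} [NormedAddCommGroup E] {f : ℝ → E}
    (hf : Continuous f) {p q C : ℝ} (hp : 0 < p)
    (hq : 0 < q) (hbot : ∀ᶠ ξ in atBot, ‖f ξ‖ ≤ C * Real.exp (p * ξ))
    (htop : ∀ᶠ ξ in atTop, ‖f ξ‖ ≤ C * Real.exp (-q * ξ)) : Integrable f := by
  refine hf.locallyIntegrable.integrable_of_isBigO_atBot_atTop
    (g := fun ξ => Real.exp (p * ξ)) (g' := fun ξ => Real.exp (-q * ξ)) ?_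
    ⟨Iic 0, Iic_mem_atBot 0, integrableOn_exp_mul_Iic hp 0⟩ ?_
    ⟨Ioi 0, Ioi_mem_atTop 0, integrableOn_exp_mul_Ioi (neg_lt_zero.2 hq) 0⟩
  · refine Asymptotics.IsBigO.of_bound C ?_
    filter_upwards [hbot] with ξ h
    simpa using h
  · refine Asymptotics.IsBigO.of_bound C ?_
    filter_upwards [htop] with ξ h
    simpa using h

/-- Shifting a horizontal contour inside a strip on which the integrand decays exponentially. -/
theorem integral_horizontal_line_eq {G : ℂ → ℂ} {a b : ℝ} (hab : a ≤ b)
    (hG : DifferentiableOn ℂ G (Complex.im ⁻¹' Icc a b)) {p q C : ℝ} (hp : 0 < p) (hq : 0 < q)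
    (hbot : ∀ᶠ ξ : ℝ in atBot, ∀ θ ∈ Icc a b,
      ‖G (ξ + θ * Complex.I)‖ ≤ C * Real.exp (p * ξ))
    (htop : ∀ᶠ ξ : ℝ in atTop, ∀ θ ∈ Icc a b,
      ‖G (ξ + θ * Complex.I)‖ ≤ C * Real.exp (-q * ξ)) :
    ∫ ξ : ℝ, G (ξ + a * Complex.I) = ∫ ξ : ℝ, G (ξ + b * Complex.I) := by
  have hint : ∀ θ ∈ Icc a b, Integrable fun ξ : ℝ => G (ξ + θ * Complex.I) := by
    intro θ hθ
    refine integrable_of_exp_bounds ?_ hp hq (hbot.mono fun ξ h => h θ hθ)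
      (htop.mono fun ξ h => h θ hθ)
    refine hG.continuousOn.comp_continuous (by fun_prop) fun ξ => ?_
    simpa using hθ
  have hlim : ∀ θ ∈ Icc a b, Tendsto (fun R : ℝ => ∫ ξ : ℝ in (-R)..R, G (ξ + θ * Complex.I))
      atTop (𝓝 (∫ ξ : ℝ, G (ξ + θ * Complex.I))) := fun θ hθ =>
    intervalIntegral_tendsto_integral (hint θ hθ) tendsto_neg_atTop_atBot tendsto_id
  have hexp : ∀ {r : ℝ}, 0 < r →
      Tendsto (fun R : ℝ => C * Real.exp (-r * R) * |b - a|) atTop (𝓝 0) := by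
    intro r hr
    have h1 : Tendsto (fun R : ℝ => -r * R) atTop atBot :=
      tendsto_id.const_mul_atTop_of_neg (neg_lt_zero.2 hr)
    simpa using ((Real.tendsto_exp_atBot.comp h1).const_mul C).mul_const |b - a|
  have hR : Tendsto (fun R : ℝ => ∫ θ : ℝ in a..b, G (R + θ * Complex.I)) atTop (𝓝 0) := by
    refine squeeze_zero_norm' ?_ (hexp hq)
    filter_upwards [htop] with R h
    refine intervalIntegral.norm_integral_le_of_norm_le_const fun θ hθ => ?_
    rw [uIoc_of_le hab] at hθ
    exact h θ ⟨hθ.1.le, hθ.2⟩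
  have hL : Tendsto (fun R : ℝ => ∫ θ : ℝ in a..b, G ((-R : ℝ) + θ * Complex.I)) atTop
      (𝓝 0) := by
    refine squeeze_zero_norm' ?_ (hexp hp)
    filter_upwards [tendsto_neg_atTop_atBot.eventually hbot] with R h
    refine intervalIntegral.norm_integral_le_of_norm_le_const fun θ hθ => ?_
    rw [uIoc_of_le hab] at hθ
    simpa using h θ ⟨hθ.1.le, hθ.2⟩
  have key : ∀ R : ℝ, (∫ ξ : ℝ in (-R)..R, G (ξ + a * Complex.I))
      - (∫ ξ : ℝ in (-R)..R, G (ξ + b * Complex.I))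
      + Complex.I • (∫ θ : ℝ in a..b, G (R + θ * Complex.I))
      - Complex.I • (∫ θ : ℝ in a..b, G ((-R : ℝ) + θ * Complex.I)) = 0 := by
    intro R
    have := Complex.integral_boundary_rect_eq_zero_of_differentiableOn G
      (⟨-R, a⟩ : ℂ) ⟨R, b⟩ (hG.mono fun w hw => by
        have := hw.2
        simpa [uIcc_of_le hab] using this)
    simpa using this
  have lim := (((hlim a ⟨le_rfl, hab⟩).sub (hlim b ⟨hab, le_rfl⟩)).add
    (hR.const_smul Complex.I)).sub (hL.const_smul Complex.I)
  have := tendsto_nhds_unique lim (tendsto_const_nhds.congr fun R => (key R).symm)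
  simpa [sub_eq_zero] using this

theorem eventually_mul_sub_mul_exp_le (A : ℝ) {δ ν : ℝ} (hδ : 0 < δ) (hν : 0 < ν) :
    ∀ᶠ ξ : ℝ in atTop, A * ξ - δ * Real.exp (ν * ξ) ≤ -ξ := by
  filter_upwards [(tendsto_exp_mul_div_rpow_atTop 1 ν hν).eventually_ge_atTop ((A + 1) / δ),
    eventually_gt_atTop 0] with ξ h hξ
  rw [Real.rpow_one, div_le_div_iff₀ hδ hξ] at h
  linarith

/-- A stretched exponential with exponent below one is eventually dominated by `exp (-c e ^ ξ)`. -/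
theorem eventually_exp_sub_exp_le {c z ν : ℝ} (hc : 0 < c) (hν : 0 < ν) (hν1 : ν < 1) :
    ∀ᶠ ξ : ℝ in atTop, z * Real.exp (ν * ξ) - c * Real.exp ξ ≤ -Real.exp (ν * ξ) := by
  have h1 : Tendsto (fun ξ : ℝ => Real.exp ((1 - ν) * ξ)) atTop atTop :=
    Real.tendsto_exp_atTop.comp (tendsto_id.const_mul_atTop (sub_pos.2 hν1))
  filter_upwards [h1.eventually_ge_atTop ((z + 1) / c)] with ξ h
  rw [div_le_iff₀ hc] at h
  have : Real.exp ξ = Real.exp ((1 - ν) * ξ) * Real.exp (ν * ξ) := by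
    rw [← Real.exp_add]; ring_nf
  rw [this]
  nlinarith [Real.exp_pos (ν * ξ)]

theorem integral_exp_mul_sub_exp {a : ℝ} (ha : 0 < a) :
    ∫ ξ : ℝ, Real.exp (a * ξ - Real.exp ξ) = Real.Gamma a := by
  rw [Real.Gamma_eq_integral ha, ← Real.range_exp, ← image_univ,
    integral_image_eq_integral_abs_deriv_smul MeasurableSet.univ
      (fun x _ => (Real.hasDerivAt_exp x).hasDerivWithinAt) Real.exp_injective.injOn,
    Measure.restrict_univ]
  refine integral_congr_ae (Eventually.of_forall fun ξ => ?_)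
  simp only [abs_of_pos (Real.exp_pos ξ), smul_eq_mul]
  rw [← Real.exp_mul, ← Real.exp_add, ← Real.exp_add]
  ring_nf

theorem integrable_exp_mul_sub_exp_add {a ν : ℝ} (ha : 0 < a) (hν : 0 < ν) (hν1 : ν < 1) (z : ℝ) :
    Integrable fun ξ : ℝ => Real.exp (a * ξ - Real.exp ξ + z * Real.exp (ν * ξ)) := by
  refine integrable_of_exp_bounds (C := Real.exp |z|) (by fun_prop) ha one_pos ?_ ?_
  · filter_upwards [eventually_le_atBot 0] with ξ hξ
    rw [Real.norm_eq_abs, Real.abs_exp, ← Real.exp_add]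
    refine Real.exp_le_exp.2 ?_
    have h1 : Real.exp (ν * ξ) ≤ 1 := Real.exp_le_one_iff.2 (by nlinarith)
    have h2 : z * Real.exp (ν * ξ) ≤ |z| * 1 :=
      mul_le_mul (le_abs_self z) h1 (Real.exp_pos _).le (abs_nonneg z)
    linarith [Real.exp_pos ξ]
  · filter_upwards [eventually_exp_sub_exp_le (z := z) one_pos hν hν1,
      eventually_mul_sub_mul_exp_le a one_pos hν] with ξ h1 h2
    rw [Real.norm_eq_abs, Real.abs_exp, ← Real.exp_add]
    refine Real.exp_le_exp.2 ?_
    linarith [abs_nonneg z]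

theorem hasSum_pow_mul_Gamma {a ν : ℝ} (ha : 0 < a) (hν : 0 < ν) (hν1 : ν < 1) {E : Type*}
    [NormedAddCommGroup E] [NormedSpace ℝ E] {z : ℝ} {F : ℕ → ℝ → E} {f : ℝ → E}
    (hF : ∀ n, Continuous (F n))
    (hle : ∀ n ξ, ‖F n ξ‖ ≤ z ^ n / n.factorial * Real.exp ((a + ν * n) * ξ - Real.exp ξ))
    (hf : ∀ ξ, HasSum (fun n => F n ξ) (f ξ)) :
    HasSum (fun n => ∫ ξ, F n ξ) (∫ ξ, f ξ) := by
  have hs : ∀ ξ : ℝ, HasSum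
      (fun n : ℕ => z ^ n / n.factorial * Real.exp ((a + ν * n) * ξ - Real.exp ξ))
      (Real.exp (a * ξ - Real.exp ξ + z * Real.exp (ν * ξ))) := by
    intro ξ
    have h := (NormedSpace.expSeries_div_hasSum_exp (𝔸 := ℝ) (z * Real.exp (ν * ξ))).mul_left
      (Real.exp (a * ξ - Real.exp ξ))
    rw [← Real.exp_eq_exp_ℝ, ← Real.exp_add] at h
    refine h.congr_fun fun n => ?_
    rw [mul_pow, ← Real.exp_nat_mul,
      show (a + ν * n) * ξ - Real.exp ξ = a * ξ - Real.exp ξ + n * (ν * ξ) by ring, Real.exp_add]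
    ring
  refine hasSum_integral_of_dominated_convergence _ (fun n => (hF n).aestronglyMeasurable)
    (fun n => Eventually.of_forall (hle n)) (Eventually.of_forall fun ξ => (hs ξ).summable) ?_
    (Eventually.of_forall hf)
  simp_rw [fun ξ => (hs ξ).tsum_eq]
  exact integrable_exp_mul_sub_exp_add ha hν hν1 z

theorem summable_pow_mul_Gamma {a ν : ℝ} (ha : 0 < a) (hν : 0 < ν) (hν1 : ν < 1) {z : ℝ}
    (hz : 0 ≤ z) :
    Summable fun n : ℕ => z ^ n / n.factorial * Real.Gamma (a + ν * n) := by
  have h := hasSum_pow_mul_Gamma (E := ℝ) ha hν hν1 (z := z)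
    (F := fun n ξ => z ^ n / n.factorial * Real.exp ((a + ν * n) * ξ - Real.exp ξ))
    (f := fun ξ => ∑' n : ℕ, z ^ n / n.factorial * Real.exp ((a + ν * n) * ξ - Real.exp ξ))
    (fun n => by fun_prop) (fun n ξ => ?_) (fun ξ => Summable.hasSum ?_)
  · refine h.summable.congr fun n => ?_
    rw [integral_const_mul, integral_exp_mul_sub_exp (by positivity)]
  · rw [Real.norm_of_nonneg (by positivity)]
  · have h := (Real.summable_pow_div_factorial (z * Real.exp (ν * ξ))).mul_left
      (Real.exp (a * ξ - Real.exp ξ))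
    refine h.congr fun n => ?_
    rw [mul_pow, ← Real.exp_nat_mul,
      show (a + ν * n) * ξ - Real.exp ξ = a * ξ - Real.exp ξ + n * (ν * ξ) by ring, Real.exp_add]
    ring

theorem inv_Gamma_eq_sin_mul_Gamma {w : ℝ} (hw : w < 1) :
    (Real.Gamma w)⁻¹ = Real.pi⁻¹ * (Real.sin (Real.pi * w) * Real.Gamma (1 - w)) := by
  have h := Real.Gamma_mul_Gamma_one_sub w
  have hpos : 0 < Real.Gamma (1 - w) := Real.Gamma_pos_of_pos (by linarith)
  rcases eq_or_ne (Real.sin (Real.pi * w)) 0 with h0 | h0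
  · rw [h0, div_zero] at h
    rw [h0, (mul_eq_zero.1 h).resolve_right hpos.ne']
    simp
  · have hG : Real.Gamma w ≠ 0 := by
      intro hG
      rw [hG, zero_mul] at h
      exact div_ne_zero Real.pi_ne_zero h0 h.symm
    rw [eq_div_iff h0] at h
    have := Real.pi_ne_zero
    field_simp
    linear_combination -h

/-- The Hankel integrand of the Wright function in logarithmic coordinates. -/
noncomputable def wrightKernel (ν μ z : ℝ) (w : ℂ) : ℂ :=
  Complex.exp (Complex.exp w + (1 - μ) * w - z * Complex.exp (ν * w))

theorem wright_eq_integral_im_pi {ν μ : ℝ} (hν : 0 < ν) (hν1 : ν < 1) (hμ : μ < 1) (z : ℝ) :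
    wright (-ν) μ (-z) =
      Real.pi⁻¹ * (∫ ξ : ℝ, wrightKernel ν μ z (ξ + Real.pi * Complex.I)).im := by
  have ha : 0 < 1 - μ := by linarith
  set c : ℕ → ℂ := fun n => Complex.exp ((1 - μ + ν * n : ℝ) * Real.pi * Complex.I) with hc
  have hF : ∀ (n : ℕ) (ξ : ℝ), Complex.exp (-Complex.exp ξ + (1 - μ) * (ξ + Real.pi * Complex.I)) *
      ((-z * Complex.exp (ν * (ξ + Real.pi * Complex.I))) ^ n / n.factorial) =
      ((-z) ^ n / n.factorial * c n) *
        (Real.exp ((1 - μ + ν * n) * ξ - Real.exp ξ) : ℝ) := by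
    intro n ξ
    simp only [hc, mul_pow, ← Complex.exp_nat_mul]
    push_cast
    have : Complex.exp (-Complex.exp ξ + (1 - μ) * (ξ + Real.pi * Complex.I)) *
        Complex.exp (n * (ν * (ξ + Real.pi * Complex.I))) =
        Complex.exp ((1 - μ + ν * n) * Real.pi * Complex.I) *
        Complex.exp ((1 - μ + ν * n) * ξ - Complex.exp ξ) := by
      rw [← Complex.exp_add, ← Complex.exp_add]
      ring_nf
    linear_combination ((-z : ℂ) ^ n / n.factorial) * this
  have hnc : ∀ n, ‖c n‖ = 1 := fun n => by
    simp only [hc]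
    rw [← Complex.ofReal_mul, Complex.norm_exp_ofReal_mul_I]
  have hsum := hasSum_pow_mul_Gamma (E := ℂ) ha hν hν1 (z := |z|)
    (F := fun n ξ => ((-z) ^ n / n.factorial * c n) *
        (Real.exp ((1 - μ + ν * n) * ξ - Real.exp ξ) : ℝ))
    (f := fun ξ => wrightKernel ν μ z (ξ + Real.pi * Complex.I))
    (fun n => by fun_prop) (fun n ξ => ?_) (fun ξ => ?_)
  · have him := Complex.hasSum_im hsum
    rw [wright, ← him.tsum_eq, ← tsum_mul_left]
    refine tsum_congr fun n => ?_
    rw [integral_const_mul, integral_complex_ofReal, integral_exp_mul_sub_exp (by positivity),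
      div_eq_mul_inv, mul_inv, inv_Gamma_eq_sin_mul_Gamma (by nlinarith [n.cast_nonneg (α := ℝ)])]
    have h1 : ((-z : ℂ) ^ n / n.factorial * c n * (Real.Gamma (1 - μ + ν * n) : ℝ)) =
        (((-z) ^ n / n.factorial * Real.Gamma (1 - μ + ν * n) : ℝ) : ℂ) * c n := by
      push_cast; ring
    rw [h1, Complex.im_ofReal_mul]
    have h2 : (c n).im = Real.sin (Real.pi * (-ν * n + μ)) := by
      simp only [hc]
      rw [← Complex.ofReal_mul, Complex.exp_ofReal_mul_I_im, ← Real.sin_pi_sub]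
      ring_nf
    rw [h2, show 1 - (-ν * n + μ) = 1 - μ + ν * n by ring]
    ring
  · rw [norm_mul, norm_mul, hnc, Complex.norm_real, Real.norm_of_nonneg (Real.exp_pos _).le]
    simp
  · have h := (NormedSpace.expSeries_div_hasSum_exp (𝔸 := ℂ)
      (-z * Complex.exp (ν * (ξ + Real.pi * Complex.I)))).mul_left
      (Complex.exp (-Complex.exp ξ + (1 - μ) * (ξ + Real.pi * Complex.I)))
    rw [← Complex.exp_eq_exp_ℂ, ← Complex.exp_add] at h
    have hk : wrightKernel ν μ z (ξ + Real.pi * Complex.I) =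
        Complex.exp (-Complex.exp ξ + (1 - μ) * (ξ + Real.pi * Complex.I) +
          -z * Complex.exp (ν * (ξ + Real.pi * Complex.I))) := by
      rw [wrightKernel, Complex.exp_add ξ, Complex.exp_pi_mul_I]
      ring_nf
    rw [hk]
    exact h.congr_fun fun n => (hF n ξ).symm

theorem norm_wrightKernel (ν μ z ξ θ : ℝ) :
    ‖wrightKernel ν μ z (ξ + θ * Complex.I)‖ =
      Real.exp (Real.exp ξ * Real.cos θ + (1 - μ) * ξ
        - z * (Real.exp (ν * ξ) * Real.cos (ν * θ))) := by
  rw [wrightKernel, Complex.norm_exp]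
  have h : (ν : ℂ) * (ξ + θ * Complex.I) = (ν * ξ : ℝ) + (ν * θ : ℝ) * Complex.I := by
    push_cast; ring
  rw [h]
  simp [Complex.exp_re]

theorem cos_mul_pi_div_two_pos {ν : ℝ} (hν : 0 < ν) (hν1 : ν < 1) :
    0 < Real.cos (ν * (Real.pi / 2)) :=
  Real.cos_pos_of_mem_Ioo ⟨by nlinarith [Real.pi_pos], by nlinarith [Real.pi_pos]⟩

theorem integrable_exp_mul_sub_mul_exp {a ν δ : ℝ} (ha : 0 < a) (hν : 0 < ν) (hδ : 0 < δ) :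
    Integrable fun ξ : ℝ => Real.exp (a * ξ - δ * Real.exp (ν * ξ)) := by
  refine integrable_of_exp_bounds (C := 1) (by fun_prop) ha one_pos ?_ ?_
  · refine Eventually.of_forall fun ξ => ?_
    rw [Real.norm_eq_abs, Real.abs_exp, one_mul]
    have := mul_pos hδ (Real.exp_pos (ν * ξ))
    exact Real.exp_le_exp.2 (by linarith)
  · filter_upwards [eventually_mul_sub_mul_exp_le a hδ hν] with ξ h
    rw [Real.norm_eq_abs, Real.abs_exp, one_mul]
    exact Real.exp_le_exp.2 (by linarith)

theorem wright_eq_integral_im_pi_div_two {ν μ z : ℝ} (hν : 0 < ν) (hν1 : ν < 1) (hμ : μ < 1)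
    (hz : 0 < z) :
    wright (-ν) μ (-z) =
      Real.pi⁻¹ * (∫ ξ : ℝ, wrightKernel ν μ z (ξ + (Real.pi / 2 : ℝ) * Complex.I)).im := by
  have hpi := Real.pi_pos
  rw [wright_eq_integral_im_pi hν hν1 hμ]
  congr 2
  symm
  refine integral_horizontal_line_eq (p := 1 - μ) (q := 1) (C := Real.exp z) (by linarith)
    ?_ (by linarith) one_pos ?_ ?_
  · refine Differentiable.differentiableOn ?_
    unfold wrightKernel
    fun_prop
  · filter_upwards [eventually_le_atBot 0] with ξ hξ θ hθ
    rw [norm_wrightKernel, ← Real.exp_add]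
    refine Real.exp_le_exp.2 ?_
    have h1 : Real.exp ξ * Real.cos θ ≤ 0 :=
      mul_nonpos_of_nonneg_of_nonpos (Real.exp_pos _).le
        (Real.cos_nonpos_of_pi_div_two_le_of_le hθ.1 (by linarith [hθ.2]))
    have h2 : Real.exp (ν * ξ) ≤ 1 := Real.exp_le_one_iff.2 (by nlinarith)
    have h3 : -1 ≤ Real.exp (ν * ξ) * Real.cos (ν * θ) := by
      nlinarith [Real.neg_one_le_cos (ν * θ), Real.exp_pos (ν * ξ)]
    nlinarith
  · set θ₀ : ℝ := Real.pi / (1 + ν) with hθ₀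
    have hθ₀1 : θ₀ + ν * θ₀ = Real.pi := by rw [hθ₀]; field_simp
    have hθ₀2 : Real.pi / 2 < θ₀ := by
      rw [hθ₀]; exact div_lt_div_of_pos_left hpi (by linarith) (by linarith)
    have hθ₀3 : 0 < ν * θ₀ := mul_pos hν (by linarith)
    set c : ℝ := Real.cos (ν * θ₀) with hc
    have hc0 : 0 < c := Real.cos_pos_of_mem_Ioo ⟨by linarith, by linarith⟩
    have hcos : Real.cos θ₀ = -c := by
      rw [hc, ← Real.cos_pi_sub, ← hθ₀1]; congr 1; ring
    set δ : ℝ := min (z * c) 1 with hδ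
    have hδ0 : 0 < δ := lt_min (mul_pos hz hc0) one_pos
    filter_upwards [eventually_exp_sub_exp_le (z := z) hc0 hν hν1,
      eventually_mul_sub_mul_exp_le (1 - μ) hδ0 hν] with ξ h1 h2 θ hθ
    rw [norm_wrightKernel, ← Real.exp_add]
    refine Real.exp_le_exp.2 ?_
    have he := Real.exp_pos ξ
    have heν := Real.exp_pos (ν * ξ)
    have key : Real.exp ξ * Real.cos θ - z * (Real.exp (ν * ξ) * Real.cos (ν * θ)) ≤
        -(δ * Real.exp (ν * ξ)) := by
      rcases le_total θ θ₀ with h | h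
      · have h3 : Real.exp ξ * Real.cos θ ≤ 0 :=
          mul_nonpos_of_nonneg_of_nonpos he.le
            (Real.cos_nonpos_of_pi_div_two_le_of_le hθ.1 (by linarith [hθ.2]))
        have h4 : c ≤ Real.cos (ν * θ) :=
          Real.cos_le_cos_of_nonneg_of_le_pi (mul_nonneg hν.le (by linarith [hθ.1]))
            (by linarith) (by nlinarith)
        have h5 : δ ≤ z * c := min_le_left _ _
        have h6 := mul_le_mul_of_nonneg_right h5 heν.le
        have h7 := mul_le_mul_of_nonneg_left h4 (mul_pos hz heν).le
        nlinarith
      · have h3 : Real.cos θ ≤ -c := hcos ▸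
          Real.cos_le_cos_of_nonneg_of_le_pi (by linarith) hθ.2 h
        have h4 := Real.neg_one_le_cos (ν * θ)
        have h5 : δ ≤ 1 := min_le_right _ _
        have h6 := mul_le_mul_of_nonneg_right h5 heν.le
        have h7 := mul_le_mul_of_nonneg_left h4 (mul_pos hz heν).le
        have h8 := mul_le_mul_of_nonneg_left h3 he.le
        nlinarith
    linarith

/-- The Laplace transform of Stanković's function as a function of `log s`, with the Jacobian of
the logarithmic substitution included. -/
noncomputable def laplaceKernel (ν μ x : ℝ) (w : ℂ) : ℂ :=
  Complex.exp ((1 - μ) * w - x * Complex.exp (ν * w))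

theorem norm_laplaceKernel (ν μ x ξ θ : ℝ) :
    ‖laplaceKernel ν μ x (ξ + θ * Complex.I)‖ =
      Real.exp ((1 - μ) * ξ - x * (Real.exp (ν * ξ) * Real.cos (ν * θ))) := by
  rw [laplaceKernel, Complex.norm_exp]
  have h : (ν : ℂ) * (ξ + θ * Complex.I) = (ν * ξ : ℝ) + (ν * θ : ℝ) * Complex.I := by
    push_cast; ring
  rw [h]
  simp [Complex.exp_re]

theorem integrable_norm_laplaceKernel {ν μ x : ℝ} (hν : 0 < ν) (hν1 : ν < 1) (hμ : μ < 1)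
    (hx : 0 < x) :
    Integrable fun ξ : ℝ => ‖laplaceKernel ν μ x (ξ + (Real.pi / 2 : ℝ) * Complex.I)‖ := by
  refine (integrable_exp_mul_sub_mul_exp (sub_pos.2 hμ) hν
    (mul_pos hx (cos_mul_pi_div_two_pos hν hν1))).congr (Eventually.of_forall fun ξ => ?_)
  simp only [norm_laplaceKernel]
  ring_nf

theorem summable_wright_of_lt_one {ν μ : ℝ} (hν : 0 < ν) (hν1 : ν < 1) (hμ : μ < 1) (z : ℝ) :
    Summable fun n : ℕ => ‖z ^ n / (n.factorial * Real.Gamma (-ν * n + μ))‖ := by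
  refine Summable.of_nonneg_of_le (fun n => norm_nonneg _) (fun n => ?_)
    ((summable_pow_mul_Gamma (sub_pos.2 hμ) hν hν1 (abs_nonneg z)).mul_left Real.pi⁻¹)
  have hpos : 0 < Real.Gamma (1 - μ + ν * n) := Real.Gamma_pos_of_pos (by
    have := mul_nonneg hν.le (n.cast_nonneg (α := ℝ)); linarith)
  rw [div_eq_mul_inv, mul_inv, inv_Gamma_eq_sin_mul_Gamma (by nlinarith [n.cast_nonneg (α := ℝ)]),
    show 1 - (-ν * n + μ) = 1 - μ + ν * n by ring]
  simp only [norm_mul, norm_inv, norm_pow, Real.norm_eq_abs, abs_of_pos hpos, Nat.abs_cast,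
    abs_of_pos Real.pi_pos]
  have h1 : 0 ≤ |z| ^ n / n.factorial * Real.Gamma (1 - μ + ν * n) * Real.pi⁻¹ := by
    have := Real.pi_pos
    positivity
  calc |z| ^ n * ((n.factorial : ℝ)⁻¹ * (Real.pi⁻¹ *
        (|Real.sin (Real.pi * (-ν * n + μ))| * Real.Gamma (1 - μ + ν * n))))
      = (|z| ^ n / n.factorial * Real.Gamma (1 - μ + ν * n) * Real.pi⁻¹) *
          |Real.sin (Real.pi * (-ν * n + μ))| := by ring
    _ ≤ (|z| ^ n / n.factorial * Real.Gamma (1 - μ + ν * n) * Real.pi⁻¹) * 1 :=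
        mul_le_mul_of_nonneg_left (Real.abs_sin_le_one _) h1
    _ = _ := by ring

theorem exists_abs_wright_le_of_lt_one {ν μ : ℝ} (hν : 0 < ν) (hν1 : ν < 1) (hμ : μ < 1) :
    ∃ C, ∀ z, 0 ≤ z → |wright (-ν) μ (-z)| ≤ C := by
  have hs := summable_wright_of_lt_one hν hν1 hμ 1
  refine ⟨max (∑' n : ℕ, ‖(1 : ℝ) ^ n / (n.factorial * Real.Gamma (-ν * n + μ))‖)
    (Real.pi⁻¹ * ∫ ξ : ℝ, ‖laplaceKernel ν μ 1 (ξ + (Real.pi / 2 : ℝ) * Complex.I)‖),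
    fun z hz => ?_⟩
  rcases le_total z 1 with h | h
  · rw [wright, ← Real.norm_eq_abs]
    refine le_max_of_le_left (tsum_of_norm_bounded hs.hasSum fun n => ?_)
    rw [norm_div, norm_div, norm_pow, norm_pow, norm_neg, norm_one, Real.norm_of_nonneg hz]
    gcongr
  · refine le_max_of_le_right ?_
    rw [wright_eq_integral_im_pi_div_two hν hν1 hμ (by linarith), abs_mul,
      abs_of_pos (inv_pos.2 Real.pi_pos)]
    refine mul_le_mul_of_nonneg_left ?_ (inv_pos.2 Real.pi_pos).le
    refine (Complex.abs_im_le_norm _).trans (norm_integral_le_of_norm_le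
      (integrable_norm_laplaceKernel hν hν1 hμ one_pos) (Eventually.of_forall fun ξ => ?_))
    rw [norm_wrightKernel, norm_laplaceKernel, Real.cos_pi_div_two]
    refine Real.exp_le_exp.2 ?_
    have := mul_pos (Real.exp_pos (ν * ξ)) (cos_mul_pi_div_two_pos hν hν1)
    nlinarith

theorem rpow_mul_wright_eq_integral {ν μ x t : ℝ} (hν : 0 < ν) (hν1 : ν < 1) (hμ : μ < 1)
    (hx : 0 < x) (ht : 0 < t) :
    t ^ (μ - 1) * wright (-ν) μ (-(x * t ^ (-ν))) =
      Real.pi⁻¹ * (∫ ξ : ℝ, Complex.exp (t * (Complex.I * Complex.exp ξ)) *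
        laplaceKernel ν μ x (ξ + (Real.pi / 2 : ℝ) * Complex.I)).im := by
  rw [wright_eq_integral_im_pi_div_two hν hν1 hμ (mul_pos hx (Real.rpow_pos_of_pos ht _)),
    ← integral_add_right_eq_self _ (Real.log t)]
  have hk : ∀ ξ : ℝ, wrightKernel ν μ (x * t ^ (-ν))
      ((ξ + Real.log t : ℝ) + (Real.pi / 2 : ℝ) * Complex.I) =
      ((t ^ (1 - μ) : ℝ) : ℂ) * (Complex.exp (t * (Complex.I * Complex.exp ξ)) *
        laplaceKernel ν μ x (ξ + (Real.pi / 2 : ℝ) * Complex.I)) := by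
    intro ξ
    have hlog : Complex.exp (Real.log t : ℝ) = t := by
      rw [← Complex.ofReal_exp, Real.exp_log ht]
    have h1 : Complex.exp ((ξ + Real.log t : ℝ) + (Real.pi / 2 : ℝ) * Complex.I) =
        t * (Complex.I * Complex.exp ξ) := by
      rw [Complex.ofReal_add, Complex.exp_add, Complex.exp_add, hlog]
      push_cast
      rw [Complex.exp_pi_div_two_mul_I]
      ring
    have h2 : ((x * t ^ (-ν) : ℝ) : ℂ) *
        Complex.exp (ν * ((ξ + Real.log t : ℝ) + (Real.pi / 2 : ℝ) * Complex.I)) =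
        x * Complex.exp (ν * (ξ + (Real.pi / 2 : ℝ) * Complex.I)) := by
      rw [Real.rpow_def_of_pos ht]
      push_cast
      rw [mul_assoc, ← Complex.exp_add]
      ring_nf
    rw [wrightKernel, laplaceKernel, h1, h2, Real.rpow_def_of_pos ht, Complex.ofReal_exp,
      ← Complex.exp_add, ← Complex.exp_add]
    push_cast
    ring_nf
  simp_rw [hk]
  rw [integral_const_mul, Complex.im_ofReal_mul]
  have : t ^ (μ - 1) * t ^ (1 - μ) = 1 := by
    rw [← Real.rpow_add ht]; simp
  linear_combination (Real.pi⁻¹ * (∫ ξ : ℝ, Complex.exp (t * (Complex.I * Complex.exp ξ)) *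
        laplaceKernel ν μ x (ξ + (Real.pi / 2 : ℝ) * Complex.I)).im) * this

theorem le_norm_sub_I_mul_exp (s ξ : ℝ) : s ≤ ‖(s : ℂ) - Complex.I * Complex.exp ξ‖ := by
  have h := Complex.abs_re_le_norm ((s : ℂ) - Complex.I * Complex.exp ξ)
  have h2 : ((s : ℂ) - Complex.I * Complex.exp ξ).re = s := by
    rw [← Complex.ofReal_exp]; simp
  rw [h2] at h
  exact (le_abs_self s).trans h

theorem continuous_laplaceKernel (ν μ x : ℝ) : Continuous (laplaceKernel ν μ x) := by
  unfold laplaceKernel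
  fun_prop

theorem integral_exp_mul_rpow_mul_wright {ν μ x s : ℝ} (hν : 0 < ν) (hν1 : ν < 1) (hμ : μ < 1)
    (hx : 0 < x) (hs : 0 < s) :
    ∫ t in Ioi (0 : ℝ), Real.exp (-s * t) * t ^ (μ - 1) * wright (-ν) μ (-(x * t ^ (-ν))) =
      Real.pi⁻¹ * (∫ ξ : ℝ, laplaceKernel ν μ x (ξ + (Real.pi / 2 : ℝ) * Complex.I) /
        (s - Complex.I * Complex.exp ξ)).im := by
  set A : ℝ → ℂ := fun ξ => laplaceKernel ν μ x (ξ + (Real.pi / 2 : ℝ) * Complex.I) with hA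
  have hAc : Continuous A := (continuous_laplaceKernel ν μ x).comp (by fun_prop)
  set Φ : ℝ → ℝ → ℂ := fun t ξ => Complex.exp ((Complex.I * Complex.exp ξ - s) * t) * A ξ with hΦ
  have hint : Integrable (Function.uncurry Φ) ((volume.restrict (Ioi 0)).prod volume) := by
    have h1 : Integrable (fun t : ℝ => Real.exp (-s * t)) (volume.restrict (Ioi 0)) :=
      integrableOn_exp_mul_Ioi (neg_lt_zero.2 hs) 0
    refine (h1.mul_prod (integrable_norm_laplaceKernel hν hν1 hμ hx)).mono'
      (Continuous.aestronglyMeasurable (by simp only [hΦ, Function.uncurry_def]; fun_prop))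
      (Eventually.of_forall fun p => ?_)
    simp only [Function.uncurry, hΦ, norm_mul, Complex.norm_exp]
    refine le_of_eq ?_
    congr 2
    rw [← Complex.ofReal_exp]
    simp
  have h1 : ∀ t ∈ Ioi (0 : ℝ),
      Real.exp (-s * t) * t ^ (μ - 1) * wright (-ν) μ (-(x * t ^ (-ν))) =
        Real.pi⁻¹ * (∫ ξ, Φ t ξ).im := by
    intro t ht
    have h2 : ∀ ξ, Φ t ξ = (Real.exp (-s * t) : ℝ) *
        (Complex.exp (t * (Complex.I * Complex.exp ξ)) * A ξ) := by
      intro ξ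
      simp only [hΦ]
      rw [Complex.ofReal_exp, ← mul_assoc, ← Complex.exp_add]
      push_cast
      ring_nf
    simp_rw [h2]
    rw [integral_const_mul, Complex.im_ofReal_mul, mul_assoc,
      rpow_mul_wright_eq_integral hν hν1 hμ hx ht]
    ring
  rw [setIntegral_congr_fun measurableSet_Ioi h1, integral_const_mul]
  congr 1
  have h3 := Complex.imCLM.integral_comp_comm hint.integral_prod_left
  simp only [Complex.imCLM_apply, Function.uncurry_apply_pair] at h3
  rw [h3, integral_integral_swap hint]
  congr 2
  funext ξ
  have hre : (Complex.I * Complex.exp ξ - s).re < 0 := by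
    rw [← Complex.ofReal_exp]; simpa using hs
  simp only [hΦ]
  rw [integral_mul_const, integral_exp_mul_complex_Ioi hre]
  simp only [Complex.ofReal_zero, mul_zero, Complex.exp_zero]
  rw [← neg_sub (s : ℂ), neg_div_neg_eq]
  ring

theorem integral_two_mul_exp_div {s : ℝ} (hs : 0 < s) :
    Integrable (fun ξ : ℝ => 2 * s * Real.exp ξ / (s ^ 2 + Real.exp ξ ^ 2)) ∧
    ∫ ξ : ℝ, 2 * s * Real.exp ξ / (s ^ 2 + Real.exp ξ ^ 2) = Real.pi := by
  have hint : Integrable (fun ξ : ℝ => 2 * s * Real.exp ξ / (s ^ 2 + Real.exp ξ ^ 2)) := by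
    have hne : ∀ ξ : ℝ, s ^ 2 + Real.exp ξ ^ 2 ≠ 0 := fun ξ => by positivity
    refine integrable_of_exp_bounds (p := 1) (q := 1) (C := 2 / s + 2 * s)
      (by fun_prop (disch := exact hne _))
      one_pos one_pos (Eventually.of_forall fun ξ => ?_) (Eventually.of_forall fun ξ => ?_)
    · have he := Real.exp_pos ξ
      rw [Real.norm_of_nonneg (by positivity), one_mul]
      calc 2 * s * Real.exp ξ / (s ^ 2 + Real.exp ξ ^ 2) ≤ 2 * s * Real.exp ξ / s ^ 2 := by
            gcongr; nlinarith
        _ = 2 / s * Real.exp ξ := by field_simp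
        _ ≤ _ := by gcongr; linarith
    · have he := Real.exp_pos ξ
      rw [Real.norm_of_nonneg (by positivity), neg_one_mul, Real.exp_neg]
      calc 2 * s * Real.exp ξ / (s ^ 2 + Real.exp ξ ^ 2)
          ≤ 2 * s * Real.exp ξ / Real.exp ξ ^ 2 := by
            gcongr; nlinarith
        _ = 2 * s * (Real.exp ξ)⁻¹ := by field_simp
        _ ≤ _ := by
            gcongr
            have : 0 < 2 / s := by positivity
            linarith
  refine ⟨hint, ?_⟩
  have hd : ∀ ξ : ℝ, HasDerivAt (fun ξ => 2 * Real.arctan (Real.exp ξ / s))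
      (2 * s * Real.exp ξ / (s ^ 2 + Real.exp ξ ^ 2)) ξ := by
    intro ξ
    refine ((((Real.hasDerivAt_exp ξ).div_const s).arctan).const_mul 2).congr_deriv ?_
    have he := Real.exp_pos ξ
    field_simp
  have hbot : Tendsto (fun ξ : ℝ => 2 * Real.arctan (Real.exp ξ / s)) atBot (𝓝 0) := by
    have := ((Real.continuous_arctan.tendsto _).comp
      (Real.tendsto_exp_atBot.div_const s)).const_mul 2
    simpa using this
  have htop : Tendsto (fun ξ : ℝ => 2 * Real.arctan (Real.exp ξ / s)) atTop (𝓝 Real.pi) := by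
    have := ((tendsto_nhds_of_tendsto_nhdsWithin Real.tendsto_arctan_atTop).comp
      (Real.tendsto_exp_atTop.atTop_div_const hs)).const_mul 2
    simpa [mul_div_cancel₀] using this
  simpa using integral_of_hasDerivAt_of_tendsto hd hint hbot htop

theorem exp_mem_slitPlane_of_im_mem_Icc {w : ℂ} (hw : w.im ∈ Icc 0 (Real.pi / 2)) :
    Complex.exp w ∈ Complex.slitPlane := by
  rw [Complex.mem_slitPlane_iff, Complex.exp_re, Complex.exp_im]
  have he := Real.exp_pos w.re
  rcases hw.1.eq_or_lt with h | h
  · left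
    simp [← h, he]
  · right
    exact (mul_pos he (Real.sin_pos_of_pos_of_lt_pi h (by linarith [hw.2, Real.pi_pos]))).ne'

theorem im_integral_laplaceKernel_div {ν μ x s : ℝ} (hν : 0 < ν) (hν1 : ν < 1) (hμ : μ < 1)
    (hμ0 : 0 ≤ μ) (hx : 0 < x) (hs : 0 < s) :
    (∫ ξ : ℝ, laplaceKernel ν μ x (ξ + (Real.pi / 2 : ℝ) * Complex.I) /
        (s - Complex.I * Complex.exp ξ)).im =
      Real.pi * (s ^ (-μ) * Real.exp (-x * s ^ ν)) := by
  have hpi := Real.pi_pos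
  set F : ℝ := s ^ (-μ) * Real.exp (-x * s ^ ν) with hF
  have hF0 : 0 < F := by positivity
  set N : ℂ → ℂ := fun σ => σ ^ (-μ : ℂ) * Complex.exp (-x * σ ^ (ν : ℂ)) - F * (2 * s / (s + σ))
    with hN
  have hNs : N s = 0 := by
    have : (s : ℂ) ≠ 0 := by exact_mod_cast hs.ne'
    simp only [hN, hF]
    rw [← two_mul, div_self (by simpa using this), mul_one, ← Complex.ofReal_neg,
      ← Complex.ofReal_cpow hs.le, ← Complex.ofReal_cpow hs.le]
    push_cast
    ring
  have hss : (s : ℂ) ∈ Complex.slitPlane := Complex.ofReal_mem_slitPlane.2 hs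
  have hNd : DifferentiableOn ℂ N Complex.slitPlane := by
    intro σ hσ
    have hne : (s : ℂ) + σ ≠ 0 := by
      intro h
      have : σ = ((-s : ℝ) : ℂ) := by push_cast; linear_combination h
      rw [this, Complex.ofReal_mem_slitPlane] at hσ
      linarith
    refine DifferentiableAt.differentiableWithinAt ?_
    simp only [hN]
    fun_prop (disch := assumption)
  have hdN : DifferentiableOn ℂ (dslope N s) Complex.slitPlane :=
    (Complex.differentiableOn_dslope (Complex.isOpen_slitPlane.mem_nhds hss)).2 hNd
  set D : ℂ → ℂ := fun w => Complex.exp w * dslope N s (Complex.exp w) with hD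
  have hDd : DifferentiableOn ℂ D (Complex.im ⁻¹' Icc 0 (Real.pi / 2)) :=
    Complex.differentiable_exp.differentiableOn.mul
      (hdN.comp Complex.differentiable_exp.differentiableOn
        fun w hw => exp_mem_slitPlane_of_im_mem_Icc hw)
  have hDeq : ∀ w : ℂ, w.im ∈ Icc 0 (Real.pi / 2) → Complex.exp w ≠ s →
      D w = F * (2 * s * Complex.exp w / ((s + Complex.exp w) * (s - Complex.exp w)))
        - laplaceKernel ν μ x w / (s - Complex.exp w) := by
    intro w hw hne
    have hlog : Complex.log (Complex.exp w) = w :=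
      Complex.log_exp (by linarith [hw.1]) (by linarith [hw.2])
    have h1 : ∀ a : ℂ, Complex.exp w ^ a = Complex.exp (a * w) := fun a => by
      rw [Complex.cpow_def_of_ne_zero (Complex.exp_ne_zero w), hlog, mul_comm]
    have h2 : laplaceKernel ν μ x w =
        Complex.exp w * (Complex.exp (-μ * w) * Complex.exp (-x * Complex.exp (ν * w))) := by
      rw [laplaceKernel, ← Complex.exp_add, ← Complex.exp_add]
      ring_nf
    have h3 : (s : ℂ) - Complex.exp w ≠ 0 := sub_ne_zero.2 hne.symm
    have h5 : (s : ℂ) + Complex.exp w ≠ 0 := by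
      intro h
      have h4 := exp_mem_slitPlane_of_im_mem_Icc hw
      rw [show Complex.exp w = ((-s : ℝ) : ℂ) by push_cast; linear_combination h,
        Complex.ofReal_mem_slitPlane] at h4
      linarith
    simp only [hD]
    rw [dslope_of_ne _ hne, slope_def_field, hNs, sub_zero, h2]
    simp only [hN, h1]
    rw [← neg_sub (s : ℂ)]
    field_simp
    ring
  have hnorm : ∀ ξ θ : ℝ, ‖Complex.exp (ξ + θ * Complex.I)‖ = Real.exp ξ := fun ξ θ => by
    simp [Complex.norm_exp]
  -- a bound for the regularised kernel away from `s`
  have hDle : ∀ ξ θ m : ℝ, θ ∈ Icc 0 (Real.pi / 2) → 0 < m → m ≤ |s - Real.exp ξ| →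
      ‖D (ξ + θ * Complex.I)‖ ≤ F * (2 * s * Real.exp ξ / (m * m)) +
        Real.exp ((1 - μ) * ξ - x * Real.cos (ν * (Real.pi / 2)) * Real.exp (ν * ξ)) / m := by
    intro ξ θ m hθ hm hle
    have hm1 : m ≤ ‖(s : ℂ) - Complex.exp (ξ + θ * Complex.I)‖ := by
      refine hle.trans ?_
      have := abs_norm_sub_norm_le (s : ℂ) (Complex.exp (ξ + θ * Complex.I))
      rwa [hnorm, Complex.norm_real, Real.norm_of_nonneg hs.le] at this
    have hm2 : m ≤ ‖(s : ℂ) + Complex.exp (ξ + θ * Complex.I)‖ := by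
      refine hle.trans ?_
      have := abs_norm_sub_norm_le (s : ℂ) (-Complex.exp (ξ + θ * Complex.I))
      rwa [norm_neg, hnorm, Complex.norm_real, Real.norm_of_nonneg hs.le, sub_neg_eq_add] at this
    have hne : Complex.exp (ξ + θ * Complex.I) ≠ s := by
      intro h
      rw [h, sub_self, norm_zero] at hm1
      linarith
    rw [hDeq _ (by simpa using hθ) hne]
    refine (norm_sub_le _ _).trans (add_le_add ?_ ?_)
    · rw [norm_mul, norm_div, norm_mul, norm_mul, norm_mul, hnorm]
      simp only [Complex.norm_real, Real.norm_of_nonneg hs.le, Real.norm_of_nonneg hF0.le,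
        Complex.norm_ofNat]
      gcongr
    · rw [norm_div, norm_laplaceKernel]
      refine div_le_div₀ (Real.exp_pos _).le (Real.exp_le_exp.2 ?_) hm hm1
      · have h1 : Real.cos (ν * (Real.pi / 2)) ≤ Real.cos (ν * θ) :=
          Real.cos_le_cos_of_nonneg_of_le_pi (mul_nonneg hν.le hθ.1) (by nlinarith)
            (by nlinarith [hθ.2])
        have := mul_le_mul_of_nonneg_left h1 (mul_pos hx (Real.exp_pos (ν * ξ))).le
        nlinarith
  have hc0 := mul_pos hx (cos_mul_pi_div_two_pos hν hν1)
  have hshift := integral_horizontal_line_eq (by positivity : (0 : ℝ) ≤ Real.pi / 2) hDd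
    (p := 1 - μ) (q := 1) (C := (F * (8 / s) + 2 / s) + (F * (8 * s) + 2)) (by linarith) one_pos
    ?_ ?_
  · have h0 : (∫ ξ : ℝ, D (ξ + (0 : ℝ) * Complex.I)).im = 0 := by
      have hreal : (fun ξ : ℝ => D (ξ + (0 : ℝ) * Complex.I)) =ᵐ[volume]
          fun ξ : ℝ => ((D ξ).re : ℂ) := by
        have : ∀ᵐ ξ : ℝ, ξ ≠ Real.log s := by
          simp [ae_iff]
        filter_upwards [this] with ξ hξ
        have hne : Real.exp ξ ≠ s := fun h => hξ (by rw [← h, Real.log_exp])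
        have hne' : Complex.exp ξ ≠ s := by rw [← Complex.ofReal_exp]; exact_mod_cast hne
        simp only [Complex.ofReal_zero, zero_mul, add_zero]
        rw [hDeq ξ (by simpa using (half_pos hpi).le) hne']
        have : (F * (2 * s * Complex.exp ξ / ((s + Complex.exp ξ) * (s - Complex.exp ξ)))
          - laplaceKernel ν μ x ξ / (s - Complex.exp ξ) : ℂ) =
          ((F * (2 * s * Real.exp ξ / ((s + Real.exp ξ) * (s - Real.exp ξ)))
          - Real.exp ((1 - μ) * ξ - x * Real.exp (ν * ξ)) / (s - Real.exp ξ) : ℝ) : ℂ) := by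
          rw [laplaceKernel]
          push_cast
          rfl
        rw [this, Complex.ofReal_re]
      rw [integral_congr_ae hreal, integral_complex_ofReal, Complex.ofReal_im]
    rw [hshift] at h0
    have hI : ∀ ξ : ℝ, Complex.exp (ξ + (Real.pi / 2 : ℝ) * Complex.I) =
        Complex.I * Complex.exp ξ := fun ξ => by
      rw [Complex.exp_add]
      push_cast
      rw [Complex.exp_pi_div_two_mul_I, mul_comm]
    have hpt : ∀ ξ : ℝ, D (ξ + (Real.pi / 2 : ℝ) * Complex.I) =
        ((F * (2 * s * Real.exp ξ / (s ^ 2 + Real.exp ξ ^ 2)) : ℝ) : ℂ) * Complex.I -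
        laplaceKernel ν μ x (ξ + (Real.pi / 2 : ℝ) * Complex.I) /
          (s - Complex.I * Complex.exp ξ) := by
      intro ξ
      have hne : Complex.I * Complex.exp ξ ≠ s := by
        intro h
        have := le_norm_sub_I_mul_exp s ξ
        rw [h, sub_self, norm_zero] at this
        linarith
      rw [hDeq _ (by simpa using (half_pos hpi).le) (by rwa [hI]), hI]
      congr 1
      have hden : ((s : ℂ) + Complex.I * Complex.exp ξ) * (s - Complex.I * Complex.exp ξ) =
          (s : ℂ) ^ 2 + Complex.exp ξ ^ 2 := by
        linear_combination (-Complex.exp ξ ^ 2) * Complex.I_sq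
      rw [hden]
      push_cast
      ring
    have hK := integral_two_mul_exp_div hs
    have hKint : Integrable fun ξ : ℝ =>
        ((F * (2 * s * Real.exp ξ / (s ^ 2 + Real.exp ξ ^ 2)) : ℝ) : ℂ) * Complex.I :=
      (hK.1.const_mul F).ofReal.mul_const Complex.I
    have hJint : Integrable fun ξ : ℝ =>
        laplaceKernel ν μ x (ξ + (Real.pi / 2 : ℝ) * Complex.I) /
          (s - Complex.I * Complex.exp ξ) := by
      refine ((integrable_norm_laplaceKernel hν hν1 hμ hx).div_const s).mono' ?_
        (Eventually.of_forall fun ξ => ?_)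
      · refine Continuous.aestronglyMeasurable (Continuous.div
          ((continuous_laplaceKernel ν μ x).comp (by fun_prop)) (by fun_prop) fun ξ h => ?_)
        have := le_norm_sub_I_mul_exp s ξ
        rw [h, norm_zero] at this
        linarith
      · rw [norm_div]
        gcongr
        exact le_norm_sub_I_mul_exp s ξ
    simp_rw [hpt] at h0
    rw [integral_sub hKint hJint, Complex.sub_im, integral_mul_const, integral_complex_ofReal,
      integral_const_mul, hK.2, Complex.im_ofReal_mul, Complex.I_im] at h0
    linarith
  · have hsmall : ∀ᶠ ξ : ℝ in atBot, Real.exp ξ ≤ s / 2 :=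
      Real.tendsto_exp_atBot.eventually (eventually_le_nhds (by positivity))
    filter_upwards [hsmall, eventually_le_atBot 0] with ξ h1 h2 θ hθ
    refine (hDle ξ θ (s / 2) hθ (by positivity)
      (le_trans (by linarith) (le_abs_self _))).trans ?_
    have h3 : Real.exp ξ ≤ Real.exp ((1 - μ) * ξ) := Real.exp_le_exp.2 (by nlinarith)
    have h4 : Real.exp ((1 - μ) * ξ - x * Real.cos (ν * (Real.pi / 2)) * Real.exp (ν * ξ)) ≤
        Real.exp ((1 - μ) * ξ) :=
      Real.exp_le_exp.2 (by linarith [mul_pos hc0 (Real.exp_pos (ν * ξ))])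
    have h5 : F * (2 * s * Real.exp ξ / (s / 2 * (s / 2))) = F * (8 / s) * Real.exp ξ := by
      field_simp; ring
    have h6 : ∀ y : ℝ, y / (s / 2) = 2 / s * y := fun y => by field_simp
    rw [h5, h6]
    have h7 := mul_le_mul_of_nonneg_left h3 (by positivity : 0 ≤ F * (8 / s))
    have h8 := mul_le_mul_of_nonneg_left h4 (by positivity : 0 ≤ 2 / s)
    have h9 : 0 ≤ (F * (8 * s) + 2) * Real.exp ((1 - μ) * ξ) := by positivity
    linarith
  · filter_upwards [Real.tendsto_exp_atTop.eventually_ge_atTop (2 * s), eventually_ge_atTop 0,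
      eventually_mul_sub_mul_exp_le (1 - μ) hc0 hν] with ξ h1 h2 h3 θ hθ
    have he := Real.exp_pos ξ
    refine (hDle ξ θ (Real.exp ξ / 2) hθ (by positivity)
      (le_trans (by linarith) (neg_le_abs _))).trans ?_
    have h4 : Real.exp ((1 - μ) * ξ - x * Real.cos (ν * (Real.pi / 2)) * Real.exp (ν * ξ)) ≤ 1 :=
      Real.exp_le_one_iff.2 (by linarith)
    have h5 : F * (2 * s * Real.exp ξ / (Real.exp ξ / 2 * (Real.exp ξ / 2))) =
        F * (8 * s) * Real.exp (-1 * ξ) := by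
      rw [neg_one_mul, Real.exp_neg]; field_simp; ring
    have h6 : ∀ y : ℝ, y / (Real.exp ξ / 2) = 2 * Real.exp (-1 * ξ) * y := fun y => by
      rw [neg_one_mul, Real.exp_neg]; field_simp
    rw [h5, h6]
    have h8 := mul_le_mul_of_nonneg_left h4 (by positivity : 0 ≤ 2 * Real.exp (-1 * ξ))
    have h9 : 0 ≤ (F * (8 / s) + 2 / s) * Real.exp (-1 * ξ) := by positivity
    linarith

theorem summable_wright {ν : ℝ} (hν : 0 < ν) (hν1 : ν < 1) (μ z : ℝ) :
    Summable fun n : ℕ => ‖z ^ n / (n.factorial * Real.Gamma (-ν * n + μ))‖ := by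
  obtain ⟨k, hk⟩ := exists_nat_gt ((μ - 1) / ν)
  rw [div_lt_iff₀ hν] at hk
  induction k generalizing μ with
  | zero => exact summable_wright_of_lt_one hν hν1 (by simp at hk; linarith) z
  | succ k ih =>
    have h := ih (μ - ν) (by push_cast at hk; linarith)
    rw [← summable_nat_add_iff 1]
    refine Summable.of_nonneg_of_le (fun n => norm_nonneg _) (fun n => ?_) (h.mul_left |z|)
    have h1 : -ν * (n + 1 : ℕ) + μ = -ν * n + (μ - ν) := by push_cast; ring
    have h2 : (n.factorial : ℝ) ≤ (n + 1).factorial := by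
      exact_mod_cast Nat.factorial_le n.le_succ
    rw [h1, norm_div, norm_div, norm_mul, norm_mul, norm_pow, norm_pow, pow_succ,
      Real.norm_natCast, Real.norm_natCast, Real.norm_eq_abs z, mul_comm (|z| ^ n),
      mul_div_assoc]
    refine mul_le_mul_of_nonneg_left ?_ (abs_nonneg z)
    rcases (norm_nonneg (Real.Gamma (-ν * n + (μ - ν)))).eq_or_lt with h0 | h0
    · rw [← h0]; simp
    · gcongr

theorem hasSum_wright {ν : ℝ} (hν : 0 < ν) (hν1 : ν < 1) (μ z : ℝ) :
    HasSum (fun n : ℕ => z ^ n / (n.factorial * Real.Gamma (-ν * n + μ))) (wright (-ν) μ z) :=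
  (summable_wright hν hν1 μ z).of_norm.hasSum

theorem measurable_wright {ν : ℝ} (hν : 0 < ν) (hν1 : ν < 1) (μ : ℝ) :
    Measurable (wright (-ν) μ) := by
  refine measurable_of_tendsto_metrizable
    (f := fun m z => ∑ n ∈ Finset.range m, z ^ n / (n.factorial * Real.Gamma (-ν * n + μ)))
    (fun m => by fun_prop) (tendsto_pi_nhds.2 fun z => ?_)
  exact (hasSum_wright hν hν1 μ z).tendsto_sum_nat

theorem wright_neg_eq_sub_integral {ν : ℝ} (hν : 0 < ν) (hν1 : ν < 1) (μ : ℝ) {z : ℝ}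
    (hz : 0 ≤ z) :
    wright (-ν) μ (-z) =
      (Real.Gamma μ)⁻¹ - ∫ y in (0 : ℝ)..z, wright (-ν) (μ - ν) (-y) := by
  have h := intervalIntegral.hasSum_integral_of_dominated_convergence (μ := volume) (a := 0)
    (b := z) (F := fun (n : ℕ) y => (-y) ^ n / (n.factorial * Real.Gamma (-ν * n + (μ - ν))))
    (f := fun y => wright (-ν) (μ - ν) (-y))
    (fun n _ => ‖z ^ n / (n.factorial * Real.Gamma (-ν * n + (μ - ν)))‖)
    (fun n => Continuous.aestronglyMeasurable (by fun_prop))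
    (fun n => Eventually.of_forall fun y hy => ?_)
    (Eventually.of_forall fun y _ => summable_wright hν hν1 (μ - ν) z)
    intervalIntegrable_const (Eventually.of_forall fun y _ => hasSum_wright hν hν1 (μ - ν) (-y))
  · have h2 := (hasSum_nat_add_iff' 1).2 (hasSum_wright hν hν1 μ (-z))
    have h3 : ∀ n : ℕ, (-z) ^ (n + 1) / ((n + 1).factorial * Real.Gamma (-ν * (n + 1 : ℕ) + μ)) =
        -∫ y in (0 : ℝ)..z, (-y) ^ n / (n.factorial * Real.Gamma (-ν * n + (μ - ν))) := by
      intro n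
      have h1 : -ν * (n + 1 : ℕ) + μ = -ν * n + (μ - ν) := by push_cast; ring
      rw [intervalIntegral.integral_div,
        intervalIntegral.integral_comp_neg (fun y => y ^ n), integral_pow, h1,
        Nat.factorial_succ]
      push_cast
      rw [neg_zero, zero_pow n.succ_ne_zero, zero_sub, neg_div, neg_div, neg_neg, div_div]
      ring_nf
    have h4 := h2.unique ((h.neg).congr_fun fun n => h3 n)
    simp [-intervalIntegral.integral_comp_neg] at h4
    linarith
  · rw [uIoc_of_le hz] at hy
    rw [norm_div, norm_div, norm_pow, norm_pow, norm_neg, Real.norm_of_nonneg hy.1.le,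
      Real.norm_of_nonneg hz]
    have := hy.1.le
    gcongr
    exact hy.2

theorem exists_abs_wright_le {ν μ : ℝ} (hν : 0 < ν) (hν1 : ν < 1) (hμ : 0 < μ) :
    ∃ (k : ℕ) (C : ℝ), k * ν < μ ∧ 0 ≤ C ∧
      ∀ z, 0 ≤ z → |wright (-ν) μ (-z)| ≤ C * (1 + z ^ k) := by
  obtain ⟨m, hm⟩ := exists_nat_gt ((μ - 1) / ν)
  rw [div_lt_iff₀ hν] at hm
  have base : ∀ μ : ℝ, 0 < μ → μ < 1 → ∃ (k : ℕ) (C : ℝ), k * ν < μ ∧ 0 ≤ C ∧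
      ∀ z, 0 ≤ z → |wright (-ν) μ (-z)| ≤ C * (1 + z ^ k) := by
    intro μ hμ hμ1
    obtain ⟨C, hC⟩ := exists_abs_wright_le_of_lt_one hν hν1 hμ1
    have hC0 : 0 ≤ C := (abs_nonneg _).trans (hC 0 le_rfl)
    refine ⟨0, C, by simpa using hμ, hC0, fun z hz => (hC z hz).trans ?_⟩
    rw [pow_zero]
    linarith
  induction m generalizing μ with
  | zero => exact base μ hμ (by simp at hm; linarith)
  | succ m ih =>
    rcases lt_or_ge μ 1 with hμ1 | hμ1
    · exact base μ hμ hμ1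
    obtain ⟨k, C, hk, hC, h⟩ := ih (μ := μ - ν) (by linarith) (by push_cast at hm; linarith)
    refine ⟨k + 1, |(Real.Gamma μ)⁻¹| + 2 * C, by push_cast; linarith, by positivity,
      fun z hz => ?_⟩
    rw [wright_neg_eq_sub_integral hν hν1 μ hz]
    have h1 : ‖∫ y in (0 : ℝ)..z, wright (-ν) (μ - ν) (-y)‖ ≤ C * (1 + z ^ k) * |z - 0| := by
      refine intervalIntegral.norm_integral_le_of_norm_le_const fun y hy => ?_
      rw [uIoc_of_le hz] at hy
      refine (h y hy.1.le).trans ?_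
      have := hy.1.le
      gcongr
      exact hy.2
    rw [sub_zero, abs_of_nonneg hz, Real.norm_eq_abs] at h1
    have h2 : z ≤ 1 + z ^ (k + 1) := by
      rcases le_total z 1 with h3 | h3
      · linarith [pow_nonneg hz (k + 1)]
      · have h4 : z ≤ z ^ (k + 1) := le_self_pow₀ h3 k.succ_ne_zero
        linarith
    have h3 : C * (1 + z ^ k) * z ≤ 2 * C * (1 + z ^ (k + 1)) := by
      have h4 := mul_le_mul_of_nonneg_left h2 hC
      have h5 : C * (1 + z ^ k) * z = C * z + C * z ^ (k + 1) := by ring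
      rw [h5]
      linarith
    have h6 : |(Real.Gamma μ)⁻¹| * 1 ≤ |(Real.Gamma μ)⁻¹| * (1 + z ^ (k + 1)) :=
      mul_le_mul_of_nonneg_left (by linarith [pow_nonneg hz (k + 1)]) (abs_nonneg _)
    refine (abs_sub _ _).trans ?_
    linarith

theorem integrableOn_exp_mul_rpow {s a : ℝ} (hs : 0 < s) (ha : 0 < a) :
    IntegrableOn (fun t : ℝ => Real.exp (-s * t) * t ^ (a - 1)) (Ioi 0) := by
  have h := integrableOn_rpow_mul_exp_neg_mul_rpow (p := 1) (s := a - 1) (b := s)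
    (by linarith) one_pos hs
  refine h.congr_fun (fun t _ => ?_) measurableSet_Ioi
  simp only [Real.rpow_one]
  ring

theorem laplace_wright_of_sub {ν μ s : ℝ} (hν : 0 < ν) (hν1 : ν < 1) (hμ : ν < μ) (hs : 0 < s)
    (ih : ∀ y, 0 < y → ∫ t in Ioi (0 : ℝ), Real.exp (-s * t) * t ^ (μ - ν - 1) *
      wright (-ν) (μ - ν) (-(y * t ^ (-ν))) = s ^ (-(μ - ν)) * Real.exp (-y * s ^ ν))
    {x : ℝ} (hx : 0 < x) :
    ∫ t in Ioi (0 : ℝ), Real.exp (-s * t) * t ^ (μ - 1) * wright (-ν) μ (-(x * t ^ (-ν))) =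
      s ^ (-μ) * Real.exp (-x * s ^ ν) := by
  have hμ0 : 0 < μ := hν.trans hμ
  set H : ℝ → ℝ → ℝ := fun t y => Real.exp (-s * t) * t ^ (μ - ν - 1) *
    wright (-ν) (μ - ν) (-(y * t ^ (-ν))) with hH
  have hint : Integrable (Function.uncurry H)
      ((volume.restrict (Ioi 0)).prod (volume.restrict (Ioc 0 x))) := by
    obtain ⟨k, C, hk, hC, h⟩ := exists_abs_wright_le hν hν1 (sub_pos.2 hμ)
    have h1 : Integrable (fun t : ℝ => Real.exp (-s * t) * t ^ (μ - ν - 1) * C +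
        Real.exp (-s * t) * t ^ (μ - ν - k * ν - 1) * (C * x ^ k)) (volume.restrict (Ioi 0)) :=
      ((integrableOn_exp_mul_rpow hs (by linarith)).mul_const C).add
        ((integrableOn_exp_mul_rpow hs (by linarith)).mul_const (C * x ^ k))
    have h2 : Integrable (fun _ : ℝ => (1 : ℝ)) (volume.restrict (Ioc 0 x)) :=
      integrable_const 1
    refine (h1.mul_prod h2).mono' ?_ ?_
    · refine Measurable.aestronglyMeasurable ?_
      have hw := measurable_wright hν hν1 (μ - ν)
      simp only [hH, Function.uncurry_def]
      fun_prop
    · rw [Measure.prod_restrict]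
      refine ae_restrict_of_forall_mem (measurableSet_Ioi.prod measurableSet_Ioc) ?_
      rintro ⟨t, y⟩ ⟨ht, hy⟩
      have ht : 0 < t := ht
      have hy : 0 < y ∧ y ≤ x := hy
      have htν := Real.rpow_pos_of_pos ht (-ν)
      simp only [Function.uncurry_apply_pair, hH, mul_one]
      rw [norm_mul, Real.norm_of_nonneg (by positivity)]
      have h3 : ‖wright (-ν) (μ - ν) (-(y * t ^ (-ν)))‖ ≤ C * (1 + (x * t ^ (-ν)) ^ k) := by
        refine (h _ (mul_pos hy.1 htν).le).trans ?_
        have := hy.1.le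
        gcongr
        exact hy.2
      refine (mul_le_mul_of_nonneg_left h3 (by positivity)).trans (le_of_eq ?_)
      have h4 : t ^ (μ - ν - k * ν - 1) = t ^ (μ - ν - 1) * (t ^ (-ν)) ^ k := by
        rw [← Real.rpow_mul_natCast ht.le, ← Real.rpow_add ht]
        ring_nf
      rw [h4, mul_pow]
      ring
  have hpt : ∀ t ∈ Ioi (0 : ℝ),
      Real.exp (-s * t) * t ^ (μ - 1) * wright (-ν) μ (-(x * t ^ (-ν))) =
        Real.exp (-s * t) * t ^ (μ - 1) * (Real.Gamma μ)⁻¹ - ∫ y in Ioc 0 x, H t y := by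
    intro t ht
    have ht : 0 < t := ht
    have htν := Real.rpow_pos_of_pos ht (-ν)
    have h1 := intervalIntegral.smul_integral_comp_mul_right (a := 0) (b := x)
      (fun y => wright (-ν) (μ - ν) (-y)) (t ^ (-ν))
    rw [zero_mul, smul_eq_mul, intervalIntegral.integral_of_le hx.le] at h1
    rw [wright_neg_eq_sub_integral hν hν1 μ (mul_pos hx htν).le, ← h1]
    simp only [hH]
    rw [integral_const_mul]
    have h2 : t ^ (μ - ν - 1) = t ^ (μ - 1) * t ^ (-ν) := by
      rw [← Real.rpow_add ht]; ring_nf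
    rw [h2]
    ring
  have hHint : Integrable (fun t => ∫ y in Ioc 0 x, H t y) (volume.restrict (Ioi 0)) :=
    hint.integral_prod_left
  rw [setIntegral_congr_fun measurableSet_Ioi hpt,
    integral_sub ((integrableOn_exp_mul_rpow hs hμ0).mul_const _) hHint,
    integral_integral_swap hint, setIntegral_congr_fun measurableSet_Ioc fun y hy => ih y hy.1,
    integral_mul_const, integral_const_mul, ← intervalIntegral.integral_of_le hx.le]
  have hsν := Real.rpow_pos_of_pos hs ν
  have h1 : ∫ t in Ioi (0 : ℝ), Real.exp (-s * t) * t ^ (μ - 1) = s ^ (-μ) * Real.Gamma μ := by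
    rw [Real.rpow_neg hs.le, ← Real.inv_rpow hs.le, ← one_div,
      ← Real.integral_rpow_mul_exp_neg_mul_Ioi hμ0 hs]
    simp_rw [mul_comm (Real.exp _), neg_mul]
  have h2 : ∫ y in (0 : ℝ)..x, Real.exp (-y * s ^ ν) =
      (s ^ ν)⁻¹ * (1 - Real.exp (-x * s ^ ν)) := by
    rw [intervalIntegral.integral_eq_sub_of_hasDerivAt
      (f := fun y => -(s ^ ν)⁻¹ * Real.exp (-y * s ^ ν)) (fun y _ => ?_)
      (Continuous.intervalIntegrable (by fun_prop) _ _)]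
    · simp; ring
    · refine ((((hasDerivAt_id y).neg.mul_const (s ^ ν)).exp).const_mul
        (-(s ^ ν)⁻¹)).congr_deriv ?_
      simp
      field_simp
  have h3 : s ^ (-(μ - ν)) = s ^ (-μ) * s ^ ν := by
    rw [← Real.rpow_add hs]; ring_nf
  have hΓ := (Real.Gamma_pos_of_pos hμ0).ne'
  rw [h1, h2, h3]
  field_simp
  ring

theorem laplace_wright {ν μ x s : ℝ} (hν : 0 < ν) (hν1 : ν < 1) (hμ : 0 ≤ μ) (hx : 0 < x)
    (hs : 0 < s) :
    ∫ t in Ioi (0 : ℝ), Real.exp (-s * t) * t ^ (μ - 1) * wright (-ν) μ (-(x * t ^ (-ν))) =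
      s ^ (-μ) * Real.exp (-x * s ^ ν) := by
  obtain ⟨m, hm⟩ := exists_nat_gt ((μ - 1) / ν)
  rw [div_lt_iff₀ hν] at hm
  induction m generalizing μ x with
  | zero =>
    have hμ1 : μ < 1 := by simp at hm; linarith
    rw [integral_exp_mul_rpow_mul_wright hν hν1 hμ1 hx hs,
      im_integral_laplaceKernel_div hν hν1 hμ1 hμ hx hs, inv_mul_cancel_left₀ Real.pi_ne_zero]
  | succ m ih =>
    rcases lt_or_ge μ 1 with hμ1 | hμ1
    · rw [integral_exp_mul_rpow_mul_wright hν hν1 hμ1 hx hs,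
        im_integral_laplaceKernel_div hν hν1 hμ1 hμ hx hs, inv_mul_cancel_left₀ Real.pi_ne_zero]
    · exact laplace_wright_of_sub hν hν1 (by linarith) hs
        (fun y hy => ih (by linarith) hy (by push_cast at hm; linarith)) hx

/-- Stanković's Laplace transform formula. -/
theorem stankovic_laplace_transform (ν μ : ℝ) (hν0 : 0 < ν) (hν1 : ν < 1)
    (hμ : 0 ≤ μ) (x : ℝ) (hx : 0 < x) (s : ℝ) (hs : 0 < s) :
    ∫ t in Set.Ioi (0 : ℝ),
        Real.exp (-s * t) * t ^ (μ - 1) * wright (-ν) μ (-(x * t ^ (-ν))) =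
      s ^ (-μ) * Real.exp (-x * s ^ ν) :=
  laplace_wright hν0 hν1 hμ hx hs
end

section
/- Let λ, μ ∈ (0,1), set ν = λμ, and let x > 0 and t > 0. Then ∫_0^∞ ( τ^{-λ} M_λ(x·τ^{-λ}) ) · ( t^{-μ} M_μ(τ·t^{-μ}) ) dτ = t^{-ν} M_ν(x·t^{-ν}); i.e. the two-variable densities 𝕄_ν(x,t) := t^{-ν} M_ν(x t^{-ν}) satisfy the composition law 𝕄_ν(x,t) = ∫_0^∞ 𝕄_λ(x,τ)·𝕄_μ(τ,t) dτ. -/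
/-- The Mainardi function `M_ν(x) := W_{-ν,1-ν}(-x)`. -/
noncomputable def mainardiM (ν x : ℝ) : ℝ := wright (-ν) (1 - ν) (-x)

/-- The two-variable `M`-Wright density `𝕄_ν(x,t) := t^{-ν} M_ν(x t^{-ν})`. -/
noncomputable def mWright2 (ν x t : ℝ) : ℝ := t ^ (-ν) * mainardiM ν (x * t ^ (-ν))

open MeasureTheory Set Filter Topology

theorem mellinConvergent_iff_integrableOn_norm {f : ℝ → ℂ} (hf : ContinuousOn f (Ioi 0)) {s : ℂ} :
    MellinConvergent f s ↔ IntegrableOn (fun t : ℝ => t ^ (s.re - 1) * ‖f t‖) (Ioi 0) :=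
  mellin_convergent_iff_norm Subset.rfl measurableSet_Ioi
    (hf.aestronglyMeasurable measurableSet_Ioi)

/-- Multiplicative convolution `x ↦ ∫_0^∞ u^κ f(x u^κ) g(u) du`. -/
noncomputable def powConv (κ : ℝ) (f g : ℝ → ℂ) (x : ℝ) : ℂ :=
  ∫ u in Ioi (0 : ℝ), ((u ^ κ : ℝ) : ℂ) * f (x * u ^ κ) * g u

theorem mellin_integrand_powConv_integrable {κ : ℝ} {f g : ℝ → ℂ} {s : ℂ}
    (hfc : ContinuousOn f (Ioi 0)) (hgc : ContinuousOn g (Ioi 0))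
    (hf : MellinConvergent f s) (hg : MellinConvergent g (1 + κ * (1 - s))) :
    Integrable (Function.uncurry fun x u : ℝ =>
        (x : ℂ) ^ (s - 1) * (((u ^ κ : ℝ) : ℂ) * f (x * u ^ κ) * g u))
      ((volume.restrict (Ioi 0)).prod (volume.restrict (Ioi 0))) := by
  have hmeas : AEStronglyMeasurable (Function.uncurry fun x u : ℝ =>
        (x : ℂ) ^ (s - 1) * (((u ^ κ : ℝ) : ℂ) * f (x * u ^ κ) * g u))
      ((volume.restrict (Ioi 0)).prod (volume.restrict (Ioi 0))) := by
    rw [Measure.prod_restrict]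
    refine ContinuousOn.aestronglyMeasurable ?_ (measurableSet_Ioi.prod measurableSet_Ioi)
    have h1 : ContinuousOn (fun p : ℝ × ℝ => (p.1 : ℂ) ^ (s - 1)) (Ioi 0 ×ˢ Ioi 0) := by
      intro p hp
      refine ContinuousAt.continuousWithinAt ?_
      refine ContinuousAt.cpow (by fun_prop) (by fun_prop) ?_
      exact Complex.ofReal_mem_slitPlane.2 hp.1
    have h2 : ContinuousOn (fun p : ℝ × ℝ => p.2 ^ κ) (Ioi 0 ×ˢ Ioi 0) := by
      intro p hp
      refine ContinuousAt.continuousWithinAt ?_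
      exact ContinuousAt.rpow (by fun_prop) (by fun_prop) (Or.inl (ne_of_gt hp.2))
    have h3 : ContinuousOn (fun p : ℝ × ℝ => f (p.1 * p.2 ^ κ)) (Ioi 0 ×ˢ Ioi 0) :=
      hfc.comp (continuousOn_fst.mul h2)
        (fun p hp => mul_pos hp.1 (Real.rpow_pos_of_pos hp.2 _))
    have h4 : ContinuousOn (fun p : ℝ × ℝ => g p.2) (Ioi 0 ×ˢ Ioi 0) :=
      hgc.comp continuousOn_snd (fun p hp => hp.2)
    exact h1.mul (((Complex.continuous_ofReal.comp_continuousOn h2).mul h3).mul h4)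
  rw [integrable_prod_iff' hmeas]
  constructor
  · refine (ae_restrict_iff' measurableSet_Ioi).2 (ae_of_all _ fun u hu => ?_)
    have h := (MellinConvergent.comp_mul_left (f := f) (s := s)
      (Real.rpow_pos_of_pos hu κ)).2 hf
    have h' := Integrable.mul_const (Integrable.const_mul h ((u ^ κ : ℝ) : ℂ)) (g u)
    refine h'.congr (ae_of_all _ fun x => ?_)
    simp only [Function.uncurry, smul_eq_mul]
    rw [mul_comm (u ^ κ) x]; ring
  · rw [mellinConvergent_iff_integrableOn_norm hgc] at hg
    refine (hg.mul_const (∫ y in Ioi (0 : ℝ), y ^ (s.re - 1) * ‖f y‖)).congr ?_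
    refine (ae_restrict_iff' measurableSet_Ioi).2 (ae_of_all _ fun u hu => ?_)
    have hu0 : (0 : ℝ) < u := hu
    have hb : 0 < u ^ κ := Real.rpow_pos_of_pos hu κ
    have hcv := integral_comp_mul_right_Ioi (fun y : ℝ => y ^ (s.re - 1) * ‖f y‖) 0 hb
    rw [zero_mul] at hcv
    have hI : ∫ y in Ioi (0 : ℝ), y ^ (s.re - 1) * ‖f y‖ =
        u ^ κ * ∫ x in Ioi (0 : ℝ), (x * u ^ κ) ^ (s.re - 1) * ‖f (x * u ^ κ)‖ := by
      rw [hcv, smul_eq_mul, mul_inv_cancel_left₀ hb.ne']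
    simp only [Function.uncurry]
    rw [hI, ← integral_const_mul, ← integral_const_mul]
    refine setIntegral_congr_fun measurableSet_Ioi fun x hx => ?_
    have hx0 : (0 : ℝ) < x := hx
    simp only [norm_mul, Complex.norm_real, Real.norm_of_nonneg hb.le]
    rw [Complex.norm_cpow_eq_rpow_re_of_pos hx0, Real.mul_rpow hx0.le hb.le,
      ← Real.rpow_mul hu0.le]
    have e : u ^ ((1 + κ * (1 - s) : ℂ).re - 1) * u ^ (κ * (s.re - 1)) = 1 := by
      rw [← Real.rpow_add hu0]
      simp only [Complex.add_re, Complex.mul_re, Complex.sub_re, Complex.one_re, Complex.ofReal_re,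
        Complex.ofReal_im, zero_mul, sub_zero]
      ring_nf
      exact Real.rpow_zero u
    simp only [Complex.sub_re, Complex.one_re]
    linear_combination (x ^ (s.re - 1) * ‖f (x * u ^ κ)‖ * ‖g u‖ * u ^ κ) * e

theorem hasMellin_powConv {κ : ℝ} {f g : ℝ → ℂ} {s : ℂ}
    (hfc : ContinuousOn f (Ioi 0)) (hgc : ContinuousOn g (Ioi 0))
    (hf : MellinConvergent f s) (hg : MellinConvergent g (1 + κ * (1 - s))) :
    HasMellin (powConv κ f g) s (mellin f s * mellin g (1 + κ * (1 - s))) := by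
  have hint := mellin_integrand_powConv_integrable hfc hgc hf hg
  refine ⟨?_, ?_⟩
  · refine hint.integral_prod_left.congr (ae_of_all _ fun x => ?_)
    simp only [Function.uncurry, powConv, smul_eq_mul]
    rw [integral_const_mul]
  · have hsw := integral_integral_swap hint
    unfold mellin powConv
    simp only [smul_eq_mul]
    simp_rw [← integral_const_mul]
    rw [hsw]
    refine setIntegral_congr_fun measurableSet_Ioi fun u hu => ?_
    have hu0 : (0 : ℝ) < u := hu
    have hb : 0 < u ^ κ := Real.rpow_pos_of_pos hu κ
    have hm := mellin_comp_mul_left f s hb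
    unfold mellin at hm
    simp only [smul_eq_mul] at hm
    have hne : (u : ℂ) ≠ 0 := Complex.ofReal_ne_zero.2 hu0.ne'
    have e1 : ((u ^ κ : ℝ) : ℂ) * ((u ^ κ : ℝ) : ℂ) ^ (-s) = (u : ℂ) ^ (1 + κ * (1 - s) - 1) := by
      nth_rw 1 [← Complex.cpow_one ((u ^ κ : ℝ) : ℂ)]
      have hb' := Complex.ofReal_ne_zero.2 hb.ne'
      rw [← Complex.cpow_add _ _ hb', Complex.cpow_def_of_ne_zero hb',
        Complex.cpow_def_of_ne_zero hne, ← Complex.ofReal_log hb.le, ← Complex.ofReal_log hu0.le,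
        Real.log_rpow hu0]
      push_cast
      ring_nf
    calc _ = ∫ x in Ioi (0 : ℝ), (((u ^ κ : ℝ) : ℂ) * g u) *
          ((x : ℂ) ^ (s - 1) * f (u ^ κ * x)) := by
          congr 1; ext x; rw [mul_comm (u ^ κ) x]; ring
      _ = _ := by
          rw [integral_const_mul, hm, ← e1]; ring

theorem continuousOn_powConv {κ C : ℝ} {f g : ℝ → ℂ}
    (hfc : ContinuousOn f (Ioi 0)) (hgc : ContinuousOn g (Ioi 0))
    (hC : ∀ x, 0 < x → ‖f x‖ ≤ C) (hg : MellinConvergent g (1 + κ)) :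
    ContinuousOn (powConv κ f g) (Ioi 0) := by
  rw [mellinConvergent_iff_integrableOn_norm hgc] at hg
  have h2 : ContinuousOn (fun u : ℝ => u ^ κ) (Ioi 0) := fun u hu =>
    (Real.continuousAt_rpow_const _ _ (Or.inl (ne_of_gt hu))).continuousWithinAt
  refine continuousOn_of_dominated ?_ ?_ (hg.const_mul C) ?_
  · intro x hx
    refine ContinuousOn.aestronglyMeasurable ?_ measurableSet_Ioi
    exact ((Complex.continuous_ofReal.comp_continuousOn h2).mul
      (hfc.comp (continuousOn_const.mul h2)
        (fun u hu => mul_pos hx (Real.rpow_pos_of_pos hu _)))).mul hgc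
  · intro x hx
    refine (ae_restrict_iff' measurableSet_Ioi).2 (ae_of_all _ fun u hu => ?_)
    have hb : 0 < u ^ κ := Real.rpow_pos_of_pos hu κ
    have := hC _ (mul_pos hx hb)
    simp only [norm_mul, Complex.norm_real, Real.norm_of_nonneg hb.le, Complex.add_re,
      Complex.one_re, Complex.ofReal_re, add_sub_cancel_left]
    calc _ ≤ u ^ κ * C * ‖g u‖ := by gcongr
      _ = _ := by ring
  · refine (ae_restrict_iff' measurableSet_Ioi).2 (ae_of_all _ fun u hu => ?_)
    have hb : 0 < u ^ κ := Real.rpow_pos_of_pos hu κ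
    exact (continuousOn_const.mul (hfc.comp (continuousOn_id.mul continuousOn_const)
        (fun x hx => mul_pos hx hb))).mul continuousOn_const

theorem exists_norm_powConv_le {κ C : ℝ} {f g : ℝ → ℂ} (hgc : ContinuousOn g (Ioi 0))
    (hC : ∀ x, 0 < x → ‖f x‖ ≤ C) (hg : MellinConvergent g (1 + κ)) :
    ∃ K, ∀ x, 0 < x → ‖powConv κ f g x‖ ≤ K := by
  rw [mellinConvergent_iff_integrableOn_norm hgc] at hg
  refine ⟨_, fun x hx => norm_integral_le_of_norm_le (hg.const_mul C) ?_⟩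
  refine (ae_restrict_iff' measurableSet_Ioi).2 (ae_of_all _ fun u hu => ?_)
  have hb : 0 < u ^ κ := Real.rpow_pos_of_pos hu κ
  have := hC _ (mul_pos hx hb)
  simp only [norm_mul, Complex.norm_real, Real.norm_of_nonneg hb.le, Complex.add_re,
    Complex.one_re, Complex.ofReal_re, add_sub_cancel_left]
  calc _ ≤ u ^ κ * C * ‖g u‖ := by gcongr
    _ = _ := by ring

/-- Functions with vanishing Mellin transform on a vertical line vanish where continuous. -/
theorem eq_of_mellin_eq_on_line {f g : ℝ → ℂ} {σ x : ℝ} (hx : 0 < x)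
    (hf : ∀ s : ℂ, s.re = σ → MellinConvergent f s)
    (hg : ∀ s : ℂ, s.re = σ → MellinConvergent g s)
    (hfg : ∀ s : ℂ, s.re = σ → mellin f s = mellin g s)
    (hfc : ContinuousAt f x) (hgc : ContinuousAt g x) : f x = g x := by
  have hz : ∀ y : ℝ, mellin (fun t => f t - g t) (σ + y * Complex.I) = 0 := fun y => by
    have h : ((σ : ℂ) + y * Complex.I).re = σ := by simp
    rw [(hasMellin_sub (hf _ h) (hg _ h)).2, hfg _ h, sub_self]
  have := mellinInv_mellin_eq σ (fun t => f t - g t) hx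
    (hasMellin_sub (hf σ (by simp)) (hg σ (by simp))).1
    (by simp [Complex.VerticalIntegrable, hz]) (hfc.sub hgc)
  rw [mellinInv] at this
  simp only [hz, smul_zero, integral_zero] at this
  exact (sub_eq_zero.1 this.symm)

theorem integrableOn_rpow_mul_exp_neg_mul {a b : ℝ} (ha : 0 < a) (hb : 0 < b) :
    IntegrableOn (fun x : ℝ => x ^ (a - 1) * Real.exp (-(x * b))) (Ioi 0) := by
  have := integrableOn_rpow_mul_exp_neg_mul_rpow (p := 1) (s := a - 1) (b := b)
    (by linarith) one_pos hb
  refine this.congr_fun (fun x _ => ?_) measurableSet_Ioi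
  simp only [Real.rpow_one]
  ring_nf

theorem norm_exp_neg_real_mul (r : ℝ) (ζ : ℂ) :
    ‖Complex.exp (-(r * ζ))‖ = Real.exp (-(r * ζ.re)) := by
  rw [Complex.norm_exp]; simp

theorem mellinConvergent_exp_neg_mul {ζ s : ℂ} (hζ : 0 < ζ.re) (hs : 0 < s.re) :
    MellinConvergent (fun r : ℝ => Complex.exp (-(r * ζ))) s := by
  rw [mellinConvergent_iff_integrableOn_norm (by fun_prop)]
  simp_rw [norm_exp_neg_real_mul]
  exact integrableOn_rpow_mul_exp_neg_mul hs hζ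

theorem differentiableOn_mellin_exp_neg_mul {s : ℂ} (hs : 0 < s.re) :
    DifferentiableOn ℂ (fun ζ : ℂ => mellin (fun r : ℝ => Complex.exp (-(r * ζ))) s)
      {ζ | 0 < ζ.re} := by
  intro ζ hζ
  have hζ0 : 0 < ζ.re := hζ
  have hU : {z : ℂ | ζ.re / 2 < z.re} ∈ 𝓝 ζ :=
    (isOpen_lt continuous_const Complex.continuous_re).mem_nhds (by
      change ζ.re / 2 < ζ.re; linarith)
  have hcp : ContinuousOn (fun t : ℝ => (t : ℂ) ^ (s - 1)) (Ioi 0) := fun t ht =>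
    (ContinuousAt.cpow (by fun_prop) (by fun_prop)
      (Complex.ofReal_mem_slitPlane.2 ht)).continuousWithinAt
  have key := hasDerivAt_integral_of_dominated_loc_of_deriv_le
    (μ := volume.restrict (Ioi (0 : ℝ)))
    (F := fun (z : ℂ) (t : ℝ) => (t : ℂ) ^ (s - 1) • Complex.exp (-(t * z)))
    (F' := fun (z : ℂ) (t : ℝ) => (t : ℂ) ^ (s - 1) • (Complex.exp (-(t * z)) * (-t)))
    (bound := fun t => t ^ ((s.re + 1) - 1) * Real.exp (-(t * (ζ.re / 2))))
    hU ?_ (mellinConvergent_exp_neg_mul hζ0 hs) ?_ ?_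
    (integrableOn_rpow_mul_exp_neg_mul (by linarith) (by linarith)) ?_
  · exact key.2.differentiableAt.differentiableWithinAt
  · refine Eventually.of_forall fun z => ?_
    exact (hcp.smul (by fun_prop)).aestronglyMeasurable measurableSet_Ioi
  · exact (hcp.smul (by fun_prop)).aestronglyMeasurable measurableSet_Ioi
  · refine (ae_restrict_iff' measurableSet_Ioi).2 (ae_of_all _ fun t ht z hz => ?_)
    have ht0 : (0 : ℝ) < t := ht
    have hz0 : ζ.re / 2 < z.re := hz
    rw [norm_smul, norm_mul, norm_exp_neg_real_mul, Complex.norm_cpow_eq_rpow_re_of_pos ht0,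
      norm_neg, Complex.norm_real, Real.norm_of_nonneg ht0.le]
    have : t ^ ((s.re + 1) - 1) = t ^ ((s - 1).re) * t := by
      rw [← Real.rpow_add_one ht0.ne']; simp
    rw [this]
    calc _ = t ^ ((s - 1).re) * t * Real.exp (-(t * z.re)) := by ring
      _ ≤ _ := by gcongr
  · refine ae_of_all _ fun t z _ => ?_
    have : HasDerivAt (fun z : ℂ => -((t : ℂ) * z)) (-(t : ℂ)) z := by
      simpa using! ((hasDerivAt_id z).const_mul (t : ℂ)).neg
    exact this.cexp.fun_const_smul ((t : ℂ) ^ (s - 1))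

/-- The Gamma integral along a rotated ray. -/
theorem mellin_exp_neg_mul {ζ s : ℂ} (hζ : 0 < ζ.re) (hs : 0 < s.re) :
    mellin (fun r : ℝ => Complex.exp (-(r * ζ))) s = ζ ^ (-s) * Complex.Gamma s := by
  have hopen : IsOpen {ζ : ℂ | 0 < ζ.re} := isOpen_lt continuous_const Complex.continuous_re
  have h1 : AnalyticOnNhd ℂ (fun ζ : ℂ => mellin (fun r : ℝ => Complex.exp (-(r * ζ))) s)
      {ζ | 0 < ζ.re} := (differentiableOn_mellin_exp_neg_mul hs).analyticOnNhd hopen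
  have h2 : AnalyticOnNhd ℂ (fun ζ : ℂ => ζ ^ (-s) * Complex.Gamma s) {ζ | 0 < ζ.re} := by
    refine DifferentiableOn.analyticOnNhd (fun z hz => ?_) hopen
    exact ((differentiableAt_id.cpow_const (Or.inl hz)).mul_const _).differentiableWithinAt
  refine h1.eqOn_of_preconnected_of_frequently_eq h2
    (convex_halfSpace_re_gt 0).isPreconnected (z₀ := 1) (by simp) ?_ hζ
  have hreal : ∀ r : ℝ, 0 < r → mellin (fun t : ℝ => Complex.exp (-(t * (r : ℂ)))) s =
      (r : ℂ) ^ (-s) * Complex.Gamma s := fun r hr => by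
    have h := Complex.integral_cpow_mul_exp_neg_mul_Ioi hs hr
    rw [one_div, Complex.inv_cpow _ _ (by
      rw [Complex.arg_ofReal_of_nonneg hr.le]; exact Real.pi_pos.ne), ← Complex.cpow_neg] at h
    rw [← h, mellin]
    simp only [smul_eq_mul, mul_comm]
  have ht : Tendsto (fun n : ℕ => ((1 + 1 / ((n : ℝ) + 1) : ℝ) : ℂ)) atTop (𝓝[≠] 1) := by
    refine tendsto_nhdsWithin_iff.2 ⟨?_, Eventually.of_forall fun n => ?_⟩
    · have := (tendsto_one_div_add_atTop_nhds_zero_nat (𝕜 := ℝ)).const_add 1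
      rw [add_zero] at this
      exact_mod_cast (Complex.continuous_ofReal.tendsto 1).comp this
    · have : (0 : ℝ) < 1 / ((n : ℝ) + 1) := by positivity
      simp only [mem_compl_iff, mem_singleton_iff, Complex.ofReal_eq_one]
      linarith
  exact ht.frequently (Frequently.of_forall fun n => hreal _ (by positivity))

theorem exists_mul_rpow_le {ν K c : ℝ} (hν0 : 0 < ν) (hν1 : ν < 1) (hK : 0 ≤ K) (hc : 0 < c) :
    ∃ C, ∀ r, 0 < r → K * r ^ ν ≤ c * r + C := by
  have ht : Tendsto (fun ρ : ℝ => K * ρ ^ (-(1 - ν))) atTop (𝓝 (K * 0)) :=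
    (tendsto_rpow_neg_atTop (by linarith)).const_mul K
  rw [mul_zero] at ht
  obtain ⟨ρ, hρ, hρ0⟩ := ((ht.eventually_lt_const hc).and (eventually_gt_atTop 0)).exists
  refine ⟨K * ρ ^ ν, fun r hr => ?_⟩
  have hb := rpow_one_add_le_one_add_mul_self (s := r / ρ - 1)
    (by have : 0 < r / ρ := by positivity
        linarith) hν0.le hν1.le
  rw [add_sub_cancel, Real.div_rpow hr.le hρ0.le] at hb
  have hρν : 0 < ρ ^ ν := Real.rpow_pos_of_pos hρ0 _
  have h1 : r ^ ν ≤ ρ ^ ν * (1 + r / ρ) := by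
    rw [div_le_iff₀ hρν] at hb
    refine hb.trans ?_
    rw [mul_comm]
    gcongr
    have : 0 < r / ρ := by positivity
    nlinarith
  have h2 : ρ ^ (-(1 - ν)) = ρ ^ ν / ρ := by
    rw [neg_sub, Real.rpow_sub_one hρ0.ne']
  rw [h2] at hρ
  calc K * r ^ ν ≤ K * (ρ ^ ν * (1 + r / ρ)) := by gcongr
    _ = K * (ρ ^ ν / ρ) * r + K * ρ ^ ν := by field_simp; ring
    _ ≤ _ := by gcongr

theorem integrableOn_exp_rpow {ν K c : ℝ} (hν0 : 0 < ν) (hν1 : ν < 1) (hK : 0 ≤ K) (hc : 0 < c) :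
    IntegrableOn (fun r : ℝ => Real.exp (K * r ^ ν) * (r ^ (ν - 1) * Real.exp (-(r * c))))
      (Ioi 0) := by
  obtain ⟨C, hC⟩ := exists_mul_rpow_le hν0 hν1 hK (half_pos hc)
  refine Integrable.mono' ((integrableOn_rpow_mul_exp_neg_mul hν0 (half_pos hc)).const_mul
    (Real.exp C)) (Measurable.aestronglyMeasurable (by fun_prop)) ?_
  refine (ae_restrict_iff' measurableSet_Ioi).2 (ae_of_all _ fun r hr => ?_)
  have hr0 : (0 : ℝ) < r := hr
  rw [Real.norm_of_nonneg (by positivity)]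
  calc _ ≤ Real.exp (c / 2 * r + C) * (r ^ (ν - 1) * Real.exp (-(r * c))) := by
        gcongr; exact hC r hr0
    _ = r ^ (ν - 1) * (Real.exp (c / 2 * r + C) * Real.exp (-(r * c))) := by ring
    _ = r ^ (ν - 1) * (Real.exp C * Real.exp (-(r * (c / 2)))) := by
        rw [← Real.exp_add, ← Real.exp_add]; ring_nf
    _ = _ := by ring

/-- The ray integral `∫_0^∞ r^{ν-1} exp(-y r^ν w) exp(-r ζ) dr`. -/
noncomputable def rayIntegral (ν : ℝ) (ζ w : ℂ) : ℝ → ℂ :=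
  powConv ν (fun y => Complex.exp (-(y * w)))
    (fun r => (r : ℂ) ^ (-1 : ℂ) • Complex.exp (-(r * ζ)))

theorem continuousOn_cpow_smul_exp (ζ : ℂ) :
    ContinuousOn (fun r : ℝ => (r : ℂ) ^ (-1 : ℂ) • Complex.exp (-(r * ζ))) (Ioi 0) :=
  ContinuousOn.smul (fun t ht => (ContinuousAt.cpow (by fun_prop) (by fun_prop)
      (Complex.ofReal_mem_slitPlane.2 ht)).continuousWithinAt) (by fun_prop)

theorem hasSum_rayIntegral {ν y : ℝ} {ζ w : ℂ} (hν0 : 0 < ν) (hν1 : ν < 1) (hζ : 0 < ζ.re) :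
    HasSum (fun n : ℕ => (-(y * w)) ^ n / (n.factorial : ℂ) *
      (ζ ^ (-(ν * (n + 1) : ℂ)) * Complex.Gamma (ν * (n + 1)))) (rayIntegral ν ζ w y) := by
  set g : ℝ → ℂ := fun r => (r : ℂ) ^ (-1 : ℂ) • Complex.exp (-(r * ζ)) with hg
  have hgn : ∀ r : ℝ, 0 < r → r ^ ν * ‖g r‖ = r ^ (ν - 1) * Real.exp (-(r * ζ.re)) := by
    intro r hr
    simp only [hg, norm_smul, norm_exp_neg_real_mul, Complex.norm_cpow_eq_rpow_re_of_pos hr]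
    rw [← mul_assoc, ← Real.rpow_add hr]
    simp [sub_eq_add_neg]
  have key := hasSum_integral_of_dominated_convergence (μ := volume.restrict (Ioi (0 : ℝ)))
    (F := fun (n : ℕ) (r : ℝ) => ((r ^ ν : ℝ) : ℂ) *
      ((-(((y * r ^ ν : ℝ) : ℂ) * w)) ^ n / (n.factorial : ℂ)) * g r)
    (f := fun r : ℝ => ((r ^ ν : ℝ) : ℂ) * Complex.exp (-(((y * r ^ ν : ℝ) : ℂ) * w)) * g r)
    (fun n r => (‖y * w‖ * r ^ ν) ^ n / n.factorial *
      (r ^ (ν - 1) * Real.exp (-(r * ζ.re)))) ?_ ?_ ?_ ?_ ?_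
  · convert! key using 2 with n
    have ha : 0 < (ν * (n + 1) : ℂ).re := by
      have : (ν * (n + 1) : ℂ) = ((ν * (n + 1) : ℝ) : ℂ) := by push_cast; rfl
      rw [this, Complex.ofReal_re]; positivity
    rw [← mellin_exp_neg_mul hζ ha, mellin, ← integral_const_mul]
    refine setIntegral_congr_fun measurableSet_Ioi fun r hr => ?_
    have hr0 : (0 : ℝ) < r := hr
    have hne : (r : ℂ) ≠ 0 := Complex.ofReal_ne_zero.2 hr0.ne'
    have e : (r : ℂ) ^ (ν * (n + 1) - 1 : ℂ) = ((r ^ ν : ℝ) : ℂ) ^ (n + 1) * (r : ℂ) ^ (-1 : ℂ) := by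
      rw [sub_eq_add_neg, Complex.cpow_add _ _ hne, Complex.ofReal_cpow hr0.le,
        ← Complex.cpow_mul_nat]
      push_cast; rfl
    simp only [hg, smul_eq_mul, e]
    push_cast
    ring
  · intro n
    refine ContinuousOn.aestronglyMeasurable ?_ measurableSet_Ioi
    have h2 : ContinuousOn (fun u : ℝ => u ^ ν) (Ioi 0) := fun u hu =>
      (Real.continuousAt_rpow_const _ _ (Or.inl (ne_of_gt hu))).continuousWithinAt
    refine ContinuousOn.mul (ContinuousOn.mul (Complex.continuous_ofReal.comp_continuousOn h2) ?_)
      (continuousOn_cpow_smul_exp ζ)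
    refine ContinuousOn.div_const (ContinuousOn.pow (ContinuousOn.neg (ContinuousOn.mul ?_
      continuousOn_const)) n) _
    exact Complex.continuous_ofReal.comp_continuousOn (continuousOn_const.mul h2)
  · intro n
    refine (ae_restrict_iff' measurableSet_Ioi).2 (ae_of_all _ fun r hr => le_of_eq ?_)
    have hr0 : (0 : ℝ) < r := hr
    have hb : 0 < r ^ ν := Real.rpow_pos_of_pos hr0 ν
    rw [← hgn r hr0]
    simp only [norm_mul, norm_div, norm_pow, norm_neg, Complex.norm_real,
      Real.norm_of_nonneg hb.le, Complex.norm_natCast]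
    ring
  · exact ae_of_all _ fun r => (Real.summable_pow_div_factorial _).mul_right _
  · refine (integrableOn_exp_rpow hν0 hν1 (norm_nonneg (y * w)) hζ).congr (ae_of_all _ fun r => ?_)
    beta_reduce
    rw [tsum_mul_right, Real.exp_eq_exp_ℝ, NormedSpace.exp_eq_tsum_div]
  · refine ae_of_all _ fun r => HasSum.mul_right _ (HasSum.mul_left _ ?_)
    rw [Complex.exp_eq_exp_ℂ]
    exact NormedSpace.expSeries_div_hasSum_exp _

theorem exp_mul_I_cpow {θ : ℝ} (h1 : -Real.pi < θ) (h2 : θ ≤ Real.pi) (a : ℂ) :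
    Complex.exp (θ * Complex.I) ^ a = Complex.exp (θ * Complex.I * a) := by
  rw [Complex.cpow_def_of_ne_zero (Complex.exp_ne_zero _), Complex.log_exp (by simpa) (by simpa)]

theorem Gamma_mul_sin_div_pi {a : ℂ} (ha : 0 < a.re) :
    Complex.Gamma a * Complex.sin (Real.pi * a) / Real.pi = (Complex.Gamma (1 - a))⁻¹ := by
  have hG := Complex.Gamma_ne_zero_of_re_pos ha
  have hpi : (Real.pi : ℂ) ≠ 0 := Complex.ofReal_ne_zero.2 Real.pi_ne_zero
  have h := Complex.Gamma_mul_Gamma_one_sub a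
  by_cases hs : Complex.sin (Real.pi * a) = 0
  · rw [hs, div_zero] at h
    rw [hs, (mul_eq_zero.1 h).resolve_left hG]
    simp
  · have h1 : Complex.Gamma (1 - a) = Real.pi / (Complex.sin (Real.pi * a) * Complex.Gamma a) := by
      rw [eq_div_iff (mul_ne_zero hs hG)]
      rw [eq_div_iff hs] at h
      linear_combination h
    rw [h1, inv_div]
    ring

/-- The opening angle of the rotated ray representing `M_ν`. -/
noncomputable def rayAngle (ν : ℝ) : ℝ := Real.pi * (ν / 2)

/-- The angle of the `ν`-th power along the rotated ray. -/
noncomputable def powAngle (ν : ℝ) : ℝ := Real.pi * (ν * (1 - ν / 2))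

/-- The contribution of a single ray to the contour representation of `M_ν`. -/
noncomputable def signedRay (ν ε : ℝ) (y : ℝ) : ℂ :=
  rayIntegral ν (Complex.exp ((-(ε * rayAngle ν) : ℝ) * Complex.I))
    (Complex.exp ((ε * powAngle ν : ℝ) * Complex.I)) y

theorem rayAngle_bounds {ν : ℝ} (hν0 : 0 < ν) (hν1 : ν < 1) :
    0 < rayAngle ν ∧ rayAngle ν < Real.pi / 2 := by
  have := Real.pi_pos
  unfold rayAngle
  constructor <;> nlinarith

theorem powAngle_bounds {ν : ℝ} (hν0 : 0 < ν) (hν1 : ν < 1) :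
    0 < powAngle ν ∧ powAngle ν < Real.pi / 2 := by
  have := Real.pi_pos
  unfold powAngle
  constructor
  · have : 0 < 1 - ν / 2 := by linarith
    positivity
  · have h : ν * (1 - ν / 2) < 1 / 2 := by nlinarith
    nlinarith

theorem exp_mul_I_re_pos {θ ε : ℝ} (hε : |ε| = 1) (h0 : 0 < θ) (h1 : θ < Real.pi / 2) :
    0 < (Complex.exp ((ε * θ : ℝ) * Complex.I)).re := by
  rw [Complex.exp_ofReal_mul_I_re]
  refine Real.cos_pos_of_mem_Ioo ?_
  rcases eq_or_eq_neg_of_abs_eq hε with rfl | rfl <;> constructor <;> linarith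

theorem exp_neg_mul_I_re_pos {θ ε : ℝ} (hε : |ε| = 1) (h0 : 0 < θ) (h1 : θ < Real.pi / 2) :
    0 < (Complex.exp ((-(ε * θ) : ℝ) * Complex.I)).re := by
  rw [← neg_mul]
  exact exp_mul_I_re_pos (by rwa [abs_neg]) h0 h1

theorem exp_signed_cpow {θ ε : ℝ} (hε : |ε| = 1) (h0 : 0 < θ) (h1 : θ < Real.pi / 2) (a : ℂ) :
    Complex.exp ((ε * θ : ℝ) * Complex.I) ^ a = Complex.exp ((ε * θ : ℝ) * Complex.I * a) := by
  have := Real.pi_pos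
  rcases eq_or_eq_neg_of_abs_eq hε with rfl | rfl <;> refine exp_mul_I_cpow ?_ ?_ _ <;> linarith

theorem exp_neg_signed_cpow {θ ε : ℝ} (hε : |ε| = 1) (h0 : 0 < θ) (h1 : θ < Real.pi / 2) (a : ℂ) :
    Complex.exp ((-(ε * θ) : ℝ) * Complex.I) ^ a =
      Complex.exp ((-(ε * θ) : ℝ) * Complex.I * a) := by
  rw [← neg_mul]
  exact exp_signed_cpow (by rwa [abs_neg]) h0 h1 a

theorem hasSum_signedRay {ν ε : ℝ} (hν0 : 0 < ν) (hν1 : ν < 1) (hε : |ε| = 1) (y : ℝ) :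
    HasSum (fun n : ℕ => (-(y : ℂ)) ^ n / (n.factorial : ℂ) * Complex.Gamma (ν * (n + 1)) *
      Complex.exp (ε * (Real.pi * (ν * (n + 1)) * Complex.I)))
      (Complex.exp ((ε * powAngle ν : ℝ) * Complex.I) * signedRay ν ε y) := by
  obtain ⟨hr0, hr1⟩ := rayAngle_bounds hν0 hν1
  have h := (hasSum_rayIntegral (y := y) (w := Complex.exp ((ε * powAngle ν : ℝ) * Complex.I))
    hν0 hν1 (exp_neg_mul_I_re_pos hε hr0 hr1)).mul_left
      (Complex.exp ((ε * powAngle ν : ℝ) * Complex.I))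
  refine h.congr_fun fun n => ?_
  rw [exp_neg_signed_cpow hε hr0 hr1, neg_mul_eq_neg_mul, mul_pow, ← Complex.exp_nat_mul]
  have e : Complex.exp (ε * (Real.pi * (ν * (n + 1)) * Complex.I)) =
      Complex.exp ((ε * powAngle ν : ℝ) * Complex.I) *
      Complex.exp (n * ((ε * powAngle ν : ℝ) * Complex.I)) *
      Complex.exp ((-(ε * rayAngle ν) : ℝ) * Complex.I * -(ν * (n + 1))) := by
    rw [← Complex.exp_add, ← Complex.exp_add]
    congr 1
    simp only [powAngle, rayAngle]
    push_cast
    ring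
  rw [e]
  ring

theorem two_sin_eq_exp_sub (z : ℂ) :
    Complex.exp ((1 : ℝ) * (z * Complex.I)) - Complex.exp ((-1 : ℝ) * (z * Complex.I)) =
      2 * Complex.I * Complex.sin z := by
  have hI := Complex.I_sq
  simp only [Complex.sin]
  push_cast
  rw [one_mul, neg_one_mul, neg_mul]
  linear_combination (Complex.exp (z * Complex.I) - Complex.exp (-(z * Complex.I))) * hI

/-- Contour representation of the Mainardi function. -/
theorem mainardiM_eq_signedRay {ν : ℝ} (hν0 : 0 < ν) (hν1 : ν < 1) (y : ℝ) :
    (mainardiM ν y : ℂ) = (2 * Real.pi * Complex.I)⁻¹ *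
      (Complex.exp ((1 * powAngle ν : ℝ) * Complex.I) * signedRay ν 1 y -
        Complex.exp ((-1 * powAngle ν : ℝ) * Complex.I) * signedRay ν (-1) y) := by
  have h := ((hasSum_signedRay hν0 hν1 (ε := 1) (by simp) y).sub
    (hasSum_signedRay hν0 hν1 (ε := -1) (by simp) y)).mul_left (2 * Real.pi * Complex.I)⁻¹
  rw [← h.tsum_eq, mainardiM, wright, Complex.ofReal_tsum]
  refine tsum_congr fun n => ?_
  have ha' : (ν * (n + 1) : ℂ) = ((ν * (n + 1) : ℝ) : ℂ) := by push_cast; rfl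
  have ha : 0 < (ν * (n + 1) : ℂ).re := by
    rw [ha', Complex.ofReal_re]; positivity
  have hpi : (Real.pi : ℂ) ≠ 0 := Complex.ofReal_ne_zero.2 Real.pi_ne_zero
  have hG := Gamma_mul_sin_div_pi ha
  have hG' : ((Real.Gamma (-ν * n + (1 - ν)) : ℝ) : ℂ) = Complex.Gamma (1 - ν * (n + 1)) := by
    rw [← Complex.Gamma_ofReal]; push_cast; ring_nf
  have hf : (n.factorial : ℂ) ≠ 0 := Nat.cast_ne_zero.2 n.factorial_ne_zero
  rw [← mul_sub, two_sin_eq_exp_sub]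
  push_cast
  rw [hG', ← div_div, div_eq_mul_inv _ (Complex.Gamma _), ← hG]
  field_simp

theorem signedRay_properties {ν ε : ℝ} (hν0 : 0 < ν) (hν1 : ν < 1) (hε : |ε| = 1) :
    ContinuousOn (signedRay ν ε) (Ioi 0) ∧ (∃ K, ∀ y, 0 < y → ‖signedRay ν ε y‖ ≤ K) ∧
    ∀ s : ℂ, 0 < s.re → s.re < 1 → HasMellin (signedRay ν ε) s
      (Complex.exp ((ε * powAngle ν : ℝ) * Complex.I * -s) * Complex.Gamma s *
        (Complex.exp ((-(ε * rayAngle ν) : ℝ) * Complex.I * -(ν * (1 - s))) *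
          Complex.Gamma (ν * (1 - s)))) := by
  obtain ⟨hr0, hr1⟩ := rayAngle_bounds hν0 hν1
  obtain ⟨hp0, hp1⟩ := powAngle_bounds hν0 hν1
  have hζ := exp_neg_mul_I_re_pos hε hr0 hr1
  have hw := exp_mul_I_re_pos hε hp0 hp1
  have hfc : ContinuousOn (fun y : ℝ => Complex.exp (-(y * Complex.exp
    ((ε * powAngle ν : ℝ) * Complex.I)))) (Ioi 0) := by fun_prop
  have hgc := continuousOn_cpow_smul_exp (Complex.exp ((-(ε * rayAngle ν) : ℝ) * Complex.I))
  have hfb : ∀ y : ℝ, 0 < y → ‖Complex.exp (-(y * Complex.exp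
      ((ε * powAngle ν : ℝ) * Complex.I)))‖ ≤ 1 := fun y hy => by
    rw [norm_exp_neg_real_mul, Real.exp_le_one_iff]
    nlinarith [mul_pos hy hw]
  have hg1 := (MellinConvergent.cpow_smul (s := 1 + ν) (a := -1)).2
    (mellinConvergent_exp_neg_mul hζ (s := 1 + ν + -1) (by simpa))
  refine ⟨continuousOn_powConv hfc hgc hfb hg1, exists_norm_powConv_le hgc hfb hg1,
    fun s hs0 hs1 => ?_⟩
  have hpos : 0 < (ν * (1 - s) : ℂ).re := by
    rw [Complex.re_ofReal_mul]
    exact mul_pos hν0 (by simpa using hs1)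
  have hs' : (1 + ν * (1 - s) + -1 : ℂ) = ν * (1 - s) := by ring
  have h := hasMellin_powConv (κ := ν) hfc hgc (mellinConvergent_exp_neg_mul hw hs0)
    (MellinConvergent.cpow_smul.2 (mellinConvergent_exp_neg_mul hζ (by rwa [hs'])))
  rw [mellin_cpow_smul, hs', mellin_exp_neg_mul hw hs0, mellin_exp_neg_mul hζ hpos,
    exp_neg_signed_cpow hε hr0 hr1, exp_signed_cpow hε hp0 hp1] at h
  exact h

theorem continuousOn_mainardiM {ν : ℝ} (hν0 : 0 < ν) (hν1 : ν < 1) :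
    ContinuousOn (fun y => (mainardiM ν y : ℂ)) (Ioi 0) := by
  simp_rw [mainardiM_eq_signedRay hν0 hν1]
  exact continuousOn_const.mul
    ((continuousOn_const.mul (signedRay_properties hν0 hν1 (by simp)).1).sub
      (continuousOn_const.mul (signedRay_properties hν0 hν1 (by simp)).1))

theorem exists_norm_mainardiM_le {ν : ℝ} (hν0 : 0 < ν) (hν1 : ν < 1) :
    ∃ K, ∀ y, 0 < y → ‖(mainardiM ν y : ℂ)‖ ≤ K := by
  obtain ⟨K₁, h₁⟩ := (signedRay_properties hν0 hν1 (ε := 1) (by simp)).2.1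
  obtain ⟨K₂, h₂⟩ := (signedRay_properties hν0 hν1 (ε := -1) (by simp)).2.1
  refine ⟨‖(2 * Real.pi * Complex.I : ℂ)⁻¹‖ * (K₁ + K₂), fun y hy => ?_⟩
  rw [mainardiM_eq_signedRay hν0 hν1, norm_mul]
  gcongr
  refine (norm_sub_le _ _).trans ?_
  rw [norm_mul, norm_mul, Complex.norm_exp_ofReal_mul_I, Complex.norm_exp_ofReal_mul_I, one_mul,
    one_mul]
  exact add_le_add (h₁ y hy) (h₂ y hy)

theorem hasMellin_mainardiM {ν : ℝ} (hν0 : 0 < ν) (hν1 : ν < 1) {s : ℂ} (hs0 : 0 < s.re)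
    (hs1 : s.re < 1) :
    HasMellin (fun y => (mainardiM ν y : ℂ)) s
      (Complex.Gamma s * (Complex.Gamma (1 - ν * (1 - s)))⁻¹) := by
  have h₁ := (signedRay_properties hν0 hν1 (ε := 1) (by simp)).2.2 s hs0 hs1
  have h₂ := (signedRay_properties hν0 hν1 (ε := -1) (by simp)).2.2 s hs0 hs1
  have h₁' := hasMellin_const_smul h₁.1 (Complex.exp ((1 * powAngle ν : ℝ) * Complex.I))
  have h₂' := hasMellin_const_smul h₂.1 (Complex.exp ((-1 * powAngle ν : ℝ) * Complex.I))
  have h₃ := hasMellin_sub h₁'.1 h₂'.1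
  have h := hasMellin_const_smul h₃.1 (2 * Real.pi * Complex.I : ℂ)⁻¹
  rw [h₃.2, h₁'.2, h₂'.2, h₁.2, h₂.2] at h
  simp only [smul_eq_mul] at h
  simp_rw [mainardiM_eq_signedRay hν0 hν1]
  convert! h using 1
  have hpos : 0 < (ν * (1 - s) : ℂ).re := by
    rw [Complex.re_ofReal_mul]
    exact mul_pos hν0 (by simpa using hs1)
  have e : ∀ ε : ℝ, Complex.exp (ε * (Real.pi * (ν * (1 - s)) * Complex.I)) =
      Complex.exp ((ε * powAngle ν : ℝ) * Complex.I) *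
      Complex.exp ((ε * powAngle ν : ℝ) * Complex.I * -s) *
      Complex.exp ((-(ε * rayAngle ν) : ℝ) * Complex.I * -(ν * (1 - s))) := fun ε => by
    rw [← Complex.exp_add, ← Complex.exp_add]
    congr 1
    simp only [powAngle, rayAngle]
    push_cast
    ring
  have hsin := two_sin_eq_exp_sub (Real.pi * (ν * (1 - s)))
  rw [e, e] at hsin
  have hpi : (Real.pi : ℂ) ≠ 0 := Complex.ofReal_ne_zero.2 Real.pi_ne_zero
  have h2 : (2 * Real.pi * Complex.I : ℂ)⁻¹ * (2 * Complex.I *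
      Complex.sin (Real.pi * (ν * (1 - s)))) = Complex.sin (Real.pi * (ν * (1 - s))) / Real.pi := by
    field_simp [Complex.I_ne_zero]
  rw [← Gamma_mul_sin_div_pi hpos, mul_div_assoc, ← h2, ← hsin]
  ring

theorem powConv_mainardiM {l μ x : ℝ} (hl0 : 0 < l) (hl1 : l < 1) (hμ0 : 0 < μ) (hμ1 : μ < 1)
    (hx : 0 < x) :
    powConv (-l) (fun y => (mainardiM l y : ℂ)) (fun y => (mainardiM μ y : ℂ)) x =
      mainardiM (l * μ) x := by
  have hν0 : 0 < l * μ := mul_pos hl0 hμ0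
  have hν1 : l * μ < 1 := by nlinarith
  have hlc := continuousOn_mainardiM hl0 hl1
  have hμc := continuousOn_mainardiM hμ0 hμ1
  obtain ⟨K, hK⟩ := exists_norm_mainardiM_le hl0 hl1
  have key : ∀ s : ℂ, s.re = 1 / 2 → HasMellin (powConv (-l) (fun y => (mainardiM l y : ℂ))
      (fun y => (mainardiM μ y : ℂ))) s
      (Complex.Gamma s * (Complex.Gamma (1 - ((l * μ : ℝ) : ℂ) * (1 - s)))⁻¹) := fun s hs => by
    have hre : (1 + ((-l : ℝ) : ℂ) * (1 - s)).re = 1 - l / 2 := by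
      rw [Complex.add_re, Complex.re_ofReal_mul]
      simp [hs]; ring
    have h1 := hasMellin_mainardiM hl0 hl1 (s := s) (by rw [hs]; norm_num) (by rw [hs]; norm_num)
    have h2 := hasMellin_mainardiM hμ0 hμ1 (s := 1 + ((-l : ℝ) : ℂ) * (1 - s))
      (by rw [hre]; linarith) (by rw [hre]; linarith)
    have hG := Complex.Gamma_ne_zero_of_re_pos (s := 1 + ((-l : ℝ) : ℂ) * (1 - s))
      (by rw [hre]; linarith)
    have h := hasMellin_powConv (κ := -l) hlc hμc h1.1 h2.1
    rw [h1.2, h2.2] at h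
    convert! h using 1
    have e1 : (1 - l * (1 - s) : ℂ) = 1 + ((-l : ℝ) : ℂ) * (1 - s) := by push_cast; ring
    have e2 : (1 - μ * (1 - (1 + ((-l : ℝ) : ℂ) * (1 - s))) : ℂ) =
      1 - ((l * μ : ℝ) : ℂ) * (1 - s) := by push_cast; ring
    rw [e1, e2, mul_assoc, inv_mul_cancel_left₀ hG]
  have hν : ∀ s : ℂ, s.re = 1 / 2 → HasMellin (fun y => (mainardiM (l * μ) y : ℂ)) s _ :=
    fun s hs => hasMellin_mainardiM hν0 hν1 (by rw [hs]; norm_num) (by rw [hs]; norm_num)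
  have hconv : MellinConvergent (fun y => (mainardiM μ y : ℂ)) (1 + ((-l : ℝ) : ℂ)) :=
    (hasMellin_mainardiM hμ0 hμ1 (by simpa using hl1) (by simpa using hl0)).1
  refine eq_of_mellin_eq_on_line (σ := 1 / 2) (g := fun y => (mainardiM (l * μ) y : ℂ)) hx
    (fun s hs => (key s hs).1) (fun s hs => (hν s hs).1)
    (fun s hs => (key s hs).2.trans (hν s hs).2.symm) ?_ ?_
  · exact (continuousOn_powConv hlc hμc hK hconv).continuousAt (Ioi_mem_nhds hx)
  · exact (continuousOn_mainardiM hν0 hν1).continuousAt (Ioi_mem_nhds hx)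

/-- Composition law `𝕄_ν(x,t) = ∫_0^∞ 𝕄_λ(x,τ)·𝕄_μ(τ,t) dτ` for `ν = λμ`. -/
theorem mWright2_composition (l μ : ℝ) (hl0 : 0 < l) (hl1 : l < 1)
    (hμ0 : 0 < μ) (hμ1 : μ < 1) (x t : ℝ) (hx : 0 < x) (ht : 0 < t) :
    ∫ τ in Set.Ioi (0 : ℝ),
        (τ ^ (-l) * mainardiM l (x * τ ^ (-l))) *
          (t ^ (-μ) * mainardiM μ (τ * t ^ (-μ))) =
      t ^ (-(l * μ)) * mainardiM (l * μ) (x * t ^ (-(l * μ))) := by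
  have hb : 0 < t ^ (-μ) := Real.rpow_pos_of_pos ht _
  have hc : 0 < t ^ (-(l * μ)) := Real.rpow_pos_of_pos ht _
  have h := powConv_mainardiM hl0 hl1 hμ0 hμ1 (mul_pos hx hc)
  rw [powConv] at h
  simp only [← Complex.ofReal_mul] at h
  rw [integral_complex_ofReal, Complex.ofReal_inj] at h
  rw [← h, ← integral_const_mul]
  have hcv := integral_comp_mul_right_Ioi (fun u : ℝ => t ^ (-(l * μ)) *
    (u ^ (-l) * mainardiM l (x * t ^ (-(l * μ)) * u ^ (-l)) * mainardiM μ u)) 0 hb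
  rw [zero_mul, smul_eq_mul] at hcv
  rw [← mul_inv_cancel_left₀ hb.ne' (∫ u in Ioi (0 : ℝ), t ^ (-(l * μ)) *
    (u ^ (-l) * mainardiM l (x * t ^ (-(l * μ)) * u ^ (-l)) * mainardiM μ u)), ← hcv,
    ← integral_const_mul]
  refine setIntegral_congr_fun measurableSet_Ioi fun τ hτ => ?_
  have hτ0 : (0 : ℝ) < τ := hτ
  have e : t ^ (-(l * μ)) * (τ * t ^ (-μ)) ^ (-l) = τ ^ (-l) := by
    rw [Real.mul_rpow hτ0.le hb.le, ← Real.rpow_mul ht.le, mul_left_comm, ← Real.rpow_add ht]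
    ring_nf
    rw [Real.rpow_zero, mul_one]
  have e' : x * t ^ (-(l * μ)) * (τ * t ^ (-μ)) ^ (-l) = x * τ ^ (-l) := by rw [mul_assoc, e]
  simp only [e']
  rw [← e]
  ring
end

section
/- Let 0 < α < 1 and x > 0. Define the extremal Lévy stable density by its convergent series L_α^{-α}(x) := (1/(πx)) · ∑_{n=1}^∞ (-x^{-α})^n · (Γ(1+nα)/n!) · sin((nπ/2)(-α-α)) = -(1/(πx)) ∑_{n=1}^∞ (-x^{-α})^n Γ(1+nα) sin(nπα)/n!. Then L_α^{-α}(x) = (1/x)·F_α(x^{-α}) = (α/x^{α+1})·M_α(x^{-α}). -/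
open scoped Real

/-- The Mainardi auxiliary function `F_ν(x) := W_{-ν,0}(-x)`. -/
noncomputable def mainardiF (ν x : ℝ) : ℝ := wright (-ν) 0 (-x)

/-- The reflection formula for the reciprocal Gamma function. -/
theorem inv_Gamma_neg {s : ℝ} (hs : 0 ≤ s) :
    (Real.Gamma (-s))⁻¹ = -(Real.Gamma (1 + s) * Real.sin (π * s) / π) := by
  have h : Real.Gamma (1 + s) ≠ 0 := (Real.Gamma_pos_of_pos (by linarith)).ne'
  have key := Real.Gamma_mul_Gamma_one_sub (-s)
  rw [sub_neg_eq_add, mul_neg, Real.sin_neg] at key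
  rw [eq_div_of_mul_eq h key]
  simp [div_eq_mul_inv]
  ring

/-- The constant term of the series of `mainardiF` vanishes. -/
theorem mainardiF_eq_tsum_succ (ν y : ℝ) :
    mainardiF ν y = ∑' n : ℕ,
      (-y) ^ (n + 1) / (((n + 1).factorial : ℝ) * Real.Gamma (-((n + 1) * ν))) := by
  unfold mainardiF wright
  rw [← Nat.succ_injective.tsum_eq]
  · refine tsum_congr fun n => ?_
    rw [Nat.succ_eq_add_one]
    push_cast
    congr 3
    ring
  · rintro (_ | n) hn
    · simp at hn
    · exact ⟨n, rfl⟩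

/-- The sine series of `mainardiF`. -/
theorem mainardiF_eq_tsum_sin {ν : ℝ} (hν : 0 ≤ ν) (y : ℝ) :
    mainardiF ν y = -(1 / π) * ∑' n : ℕ,
      (-y) ^ (n + 1) * Real.Gamma (1 + (n + 1) * ν) *
        Real.sin ((n + 1) * π * ν) / ((n + 1).factorial : ℝ) := by
  rw [mainardiF_eq_tsum_succ, ← tsum_mul_left]
  refine tsum_congr fun n => ?_
  rw [div_eq_mul_inv, mul_inv, inv_Gamma_neg (by positivity),
    show π * ((n + 1) * ν) = (n + 1) * π * ν by ring]
  ring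

/-- The functions `mainardiF` and `mainardiM` are related by `F_ν(y) = ν y M_ν(y)`. -/
theorem mainardiF_eq_mul_mainardiM {ν : ℝ} (hν : ν ≠ 0) (y : ℝ) :
    mainardiF ν y = ν * y * mainardiM ν y := by
  rw [mainardiF_eq_tsum_succ, mainardiM, wright, ← tsum_mul_left]
  refine tsum_congr fun n => ?_
  have hn : (n + 1 : ℝ) ≠ 0 := by positivity
  have hs : -((n + 1) * ν) ≠ 0 := neg_ne_zero.2 (mul_ne_zero hn hν)
  rw [show -ν * n + (1 - ν) = -((n + 1) * ν) + 1 by ring, Real.Gamma_add_one hs,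
    Nat.factorial_succ]
  push_cast
  simp only [div_eq_mul_inv, mul_inv, pow_succ]
  field_simp

/-- The unilateral extremal Lévy stable density `L_α^{-α}` expressed through the
Mainardi auxiliary functions, for `0 < α < 1` and `x > 0`. -/
theorem extremal_stable_unilateral (α : ℝ) (hα0 : 0 < α) (hα1 : α < 1)
    (x : ℝ) (hx : 0 < x) (L : ℝ)
    (hL : L = -(1 / (π * x)) * ∑' n : ℕ,
      (-(x ^ (-α))) ^ (n + 1) * Real.Gamma (1 + (n + 1) * α) *
        Real.sin ((n + 1) * π * α) / ((n + 1).factorial : ℝ)) :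
    L = (1 / x) * mainardiF α (x ^ (-α)) ∧
    L = (α / x ^ (α + 1)) * mainardiM α (x ^ (-α)) := by
  have hF : L = (1 / x) * mainardiF α (x ^ (-α)) := by
    rw [hL, mainardiF_eq_tsum_sin hα0.le, ← mul_assoc]
    congr 1
    field_simp
  refine ⟨hF, ?_⟩
  rw [hF, mainardiF_eq_mul_mainardiM hα0.ne', Real.rpow_neg hx.le, Real.rpow_add_one hx.ne']
  have hxα : x ^ α ≠ 0 := (Real.rpow_pos_of_pos hx α).ne'
  field_simp
end

section
/- Let a > 0 and s > 0. Then ∫_0^∞ e^{-s t} · ( 1 - (2/√π) ∫_0^{a/(2√t)} e^{-u²} du ) dt = e^{-a·√s}/s; that is, the Laplace transform of t ↦ erfc(a/(2√t)) is s^{-1} e^{-a√s}. -/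
open scoped Real

/-- The complementary error function. -/
noncomputable def Real.erfc (x : ℝ) : ℝ :=
  1 - (2 / Real.sqrt π) * ∫ u in (0 : ℝ)..x, Real.exp (-u ^ 2)

namespace Real

open Filter Topology MeasureTheory Set

lemma hasDerivAt_erfc (x : ℝ) : HasDerivAt erfc (-(2 / √π * exp (-x ^ 2))) x := by
  have hc : Continuous fun u : ℝ => exp (-u ^ 2) := by fun_prop
  exact ((hc.integral_hasStrictDerivAt 0 x).hasDerivAt.const_mul _).const_sub 1

lemma antitone_erfc : Antitone erfc :=
  antitone_of_hasDerivAt_nonpos hasDerivAt_erfc fun x =>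
    neg_nonpos.2 (by positivity : 0 ≤ 2 / √π * exp (-x ^ 2))

lemma tendsto_erfc_atTop : Tendsto erfc atTop (𝓝 0) := by
  have hi : IntegrableOn (fun u : ℝ => exp (-u ^ 2)) (Ioi 0) := by
    simpa using (integrable_exp_neg_mul_sq one_pos).integrableOn (s := Ioi 0)
  have hv : ∫ u in Ioi (0 : ℝ), exp (-u ^ 2) = √π / 2 := by
    simpa using integral_gaussian_Ioi 1
  have h := ((intervalIntegral_tendsto_integral_Ioi 0 hi tendsto_id).const_mul (2 / √π)).const_sub 1
  have hπ : √π ≠ 0 := by positivity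
  rw [hv, show (1 : ℝ) - 2 / √π * (√π / 2) = 0 by field_simp; ring] at h
  exact h

lemma erfc_nonneg (x : ℝ) : 0 ≤ erfc x :=
  antitone_erfc.le_of_tendsto tendsto_erfc_atTop x

lemma erfc_neg (x : ℝ) : erfc (-x) = 2 - erfc x := by
  have h : ∫ u in (0 : ℝ)..(-x), exp (-u ^ 2) = -∫ u in (0 : ℝ)..x, exp (-u ^ 2) := by
    have := intervalIntegral.integral_comp_neg (a := 0) (b := x) fun u : ℝ => exp (-u ^ 2)
    simp only [neg_zero, neg_sq] at this
    rw [this, intervalIntegral.integral_symm]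
  rw [erfc, erfc, h]
  ring

lemma tendsto_erfc_atBot : Tendsto erfc atBot (𝓝 2) := by
  have h := (tendsto_erfc_atTop.comp tendsto_neg_atBot_atTop).const_sub 2
  simpa [Function.comp_def, erfc_neg] using h

/-- An antiderivative of `t ↦ exp (-r ^ 2 * t) * erfc (a / (2 * √t))` on the positive half-line. -/
noncomputable def erfcLaplacePrimitive (a r t : ℝ) : ℝ :=
  (exp (-a * r) * erfc (a / (2 * √t) - r * √t) + exp (a * r) * erfc (a / (2 * √t) + r * √t)
    - 2 * (exp (-r ^ 2 * t) * erfc (a / (2 * √t)))) / (2 * r ^ 2)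

lemma hasDerivAt_erfcLaplacePrimitive (a : ℝ) {r t : ℝ} (hr : r ≠ 0) (ht : 0 < t) :
    HasDerivAt (erfcLaplacePrimitive a r) (exp (-r ^ 2 * t) * erfc (a / (2 * √t))) t := by
  have hs : √t ≠ 0 := by positivity
  have hsq : √t ^ 2 = t := sq_sqrt ht.le
  have h1 : HasDerivAt (fun t => √t) (1 / (2 * √t)) t := hasDerivAt_sqrt ht.ne'
  have h2 : HasDerivAt (fun t => a / (2 * √t)) (-a / (4 * √t ^ 3)) t := by
    convert! (h1.const_mul 2).fun_inv (by positivity) |>.const_mul a using 1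
    field_simp
    ring
  have h3 := h1.const_mul r
  have h4 : HasDerivAt (fun t => exp (-r ^ 2 * t)) (exp (-r ^ 2 * t) * (-r ^ 2 * 1)) t :=
    ((hasDerivAt_id t).const_mul (-r ^ 2)).exp
  have hm := ((hasDerivAt_erfc _).comp t (h2.sub h3)).const_mul (exp (-a * r))
  have hp := ((hasDerivAt_erfc _).comp t (h2.add h3)).const_mul (exp (a * r))
  have h0 := (h4.mul ((hasDerivAt_erfc _).comp t h2)).const_mul 2
  have key := ((hm.add hp).sub h0).div_const (2 * r ^ 2)
  have em : exp (-a * r) * exp (-(a / (2 * √t) - r * √t) ^ 2)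
      = exp (-r ^ 2 * t) * exp (-(a / (2 * √t)) ^ 2) := by
    rw [← exp_add, ← exp_add, ← hsq]
    congr 1
    simp only [sqrt_sq (sqrt_nonneg t)]
    field_simp
    ring
  have ep : exp (a * r) * exp (-(a / (2 * √t) + r * √t) ^ 2)
      = exp (-r ^ 2 * t) * exp (-(a / (2 * √t)) ^ 2) := by
    rw [← exp_add, ← exp_add, ← hsq]
    congr 1
    simp only [sqrt_sq (sqrt_nonneg t)]
    field_simp
    ring
  refine key.congr_deriv ?_
  simp only [Pi.sub_apply, Pi.add_apply, Function.comp_apply]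
  rw [div_eq_iff (by positivity)]
  linear_combination (-(2 / √π) * (-a / (4 * √t ^ 3) - r * (1 / (2 * √t)))) * em
    + (-(2 / √π) * (-a / (4 * √t ^ 3) + r * (1 / (2 * √t)))) * ep

lemma tendsto_erfcLaplacePrimitive_zero {a : ℝ} (ha : 0 < a) (r : ℝ) :
    Tendsto (erfcLaplacePrimitive a r) (𝓝[>] 0) (𝓝 0) := by
  have hs : Tendsto (fun t : ℝ => √t) (𝓝[>] 0) (𝓝 0) := by
    simpa using (continuous_sqrt.tendsto 0).mono_left nhdsWithin_le_nhds
  have hd : Tendsto (fun t : ℝ => a / (2 * √t)) (𝓝[>] 0) atTop := by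
    have : Tendsto (fun t : ℝ => √t) (𝓝[>] 0) (𝓝[>] 0) :=
      tendsto_nhdsWithin_iff.2 ⟨hs, eventually_mem_nhdsWithin.mono fun t ht => sqrt_pos.2 ht⟩
    refine ((tendsto_inv_nhdsGT_zero.comp this).const_mul_atTop (half_pos ha)).congr fun t => ?_
    simp only [Function.comp_apply]
    rw [div_mul_eq_div_div, div_eq_mul_inv (a / 2)]
  have hrs := hs.const_mul r
  have hm := (tendsto_erfc_atTop.comp (hd.atTop_add hrs.neg)).const_mul (exp (-a * r))
  have hp := (tendsto_erfc_atTop.comp (hd.atTop_add hrs)).const_mul (exp (a * r))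
  have he : Tendsto (fun t : ℝ => exp (-r ^ 2 * t)) (𝓝[>] 0) (𝓝 (exp (-r ^ 2 * 0))) :=
    ((by fun_prop : Continuous fun t : ℝ => exp (-r ^ 2 * t)).tendsto 0).mono_left
      nhdsWithin_le_nhds
  have h0 := (he.mul (tendsto_erfc_atTop.comp hd)).const_mul 2
  have := ((hm.add hp).sub h0).div_const (2 * r ^ 2)
  simpa only [mul_zero, add_zero, sub_zero, zero_div, ← sub_eq_add_neg] using! this

lemma tendsto_erfcLaplacePrimitive_atTop (a : ℝ) {r : ℝ} (hr : 0 < r) :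
    Tendsto (erfcLaplacePrimitive a r) atTop (𝓝 (exp (-a * r) / r ^ 2)) := by
  have hd : Tendsto (fun t : ℝ => a / (2 * √t)) atTop (𝓝 0) :=
    (tendsto_sqrt_atTop.const_mul_atTop two_pos).const_div_atTop a
  have hrs := tendsto_sqrt_atTop.const_mul_atTop hr
  have hm := (tendsto_erfc_atBot.comp
    (hd.add_atBot (tendsto_neg_atTop_atBot.comp hrs))).const_mul (exp (-a * r))
  have hp := (tendsto_erfc_atTop.comp (hd.add_atTop hrs)).const_mul (exp (a * r))
  have he : Tendsto (fun t : ℝ => exp (-r ^ 2 * t)) atTop (𝓝 0) :=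
    tendsto_exp_atBot.comp (tendsto_id.const_mul_atTop_of_neg (by simpa using by positivity))
  have h0 := (he.mul (((hasDerivAt_erfc 0).continuousAt.tendsto).comp hd)).const_mul 2
  have := ((hm.add hp).sub h0).div_const (2 * r ^ 2)
  rw [show (exp (-a * r) * 2 + exp (a * r) * 0 - 2 * (0 * erfc 0)) / (2 * r ^ 2)
    = exp (-a * r) / r ^ 2 by field_simp; ring] at this
  simpa only [Function.comp_def, ← sub_eq_add_neg] using! this

lemma integral_exp_mul_erfc {a r : ℝ} (ha : 0 < a) (hr : 0 < r) :
    ∫ t in Ioi (0 : ℝ), exp (-r ^ 2 * t) * erfc (a / (2 * √t)) = exp (-a * r) / r ^ 2 := by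
  have h := integral_Ioi_of_hasDerivAt_of_nonneg (a := 0)
    (g := Function.update (erfcLaplacePrimitive a r) 0 0)
    (g' := fun t => exp (-r ^ 2 * t) * erfc (a / (2 * √t))) (l := exp (-a * r) / r ^ 2)
    (by
      rw [continuousWithinAt_update_same, Ici_sdiff_left]
      exact tendsto_erfcLaplacePrimitive_zero ha r)
    (fun t ht => (hasDerivAt_erfcLaplacePrimitive a hr.ne' ht).congr_of_eventuallyEq <| by
      filter_upwards [isOpen_ne.mem_nhds (ne_of_gt ht)] with x hx
      exact Function.update_of_ne hx _ _)
    (fun t _ => mul_nonneg (exp_pos _).le (erfc_nonneg _))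
    ((tendsto_erfcLaplacePrimitive_atTop a hr).congr' <| by
      filter_upwards [eventually_ne_atTop 0] with x hx
      exact (Function.update_of_ne hx _ _).symm)
  simpa using h

end Real

theorem laplace_erfc_step_response (a : ℝ) (ha : 0 < a) (s : ℝ) (hs : 0 < s) :
    ∫ t in Set.Ioi (0 : ℝ),
        Real.exp (-s * t) *
          (1 - (2 / Real.sqrt π) *
            ∫ u in (0 : ℝ)..(a / (2 * Real.sqrt t)), Real.exp (-u ^ 2)) =
      Real.exp (-a * Real.sqrt s) / s := by
  have h := Real.integral_exp_mul_erfc ha (Real.sqrt_pos.2 hs)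
  rwa [Real.sq_sqrt hs.le] at h
end
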